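/- arXiv:1601.03361 — 2 statements merged into one kernel-verified Lean document; each statement's English description precedes it below -/
import Mathlib

section
/- Let G be a locally finite acyclic Borel graph on a standard Borel space X such that no connected component of G has exactly 0 ends or exactly 2 ends, and let τ be a Polish topology on X compatible with its Borel structure. Then there is a τ-comeager Borel set B ⊆ X and a one-ended Borel function f : B → X whose graph is contained in G. -/
open MeasureTheory

/-- A partial function `f : B → X` is *one-ended* if there is no infinite sequence
`x₀, x₁, x₂, …` of points of `B` with `f (x_{i+1}) = x_i` for all `i`. -/
def OneEnded {X : Type*} {B : Set X} (f : B → X) : Prop :=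
  ¬ ∃ u : ℕ → B, ∀ i : ℕ, f (u (i + 1)) = (u i : X)

/-- A set of vertices is `G`-invariant if it is a union of connected components of `G`. -/
def GraphInvariant {X : Type*} (G : SimpleGraph X) (A : Set X) : Prop :=
  ∀ ⦃x y : X⦄, G.Reachable x y → x ∈ A → y ∈ A

/-- `[A]_{E_G}`: the union of all connected components of `G` meeting `A`. -/
def EGSat {X : Type*} (G : SimpleGraph X) (A : Set X) : Set X :=
  {x | ∃ a ∈ A, G.Reachable x a}

/-- `S` is biconnected: the induced subgraph on `S` is connected and remains connected
(in the sense of `Preconnected`) after deleting any single vertex of `S`. -/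
def BiconnectedSet {X : Type*} (G : SimpleGraph X) (S : Set X) : Prop :=
  (G.induce S).Connected ∧ ∀ x ∈ S, (G.induce (S \ {x})).Preconnected

/-- A block of `G` is a maximal biconnected set. -/
def GraphBlock {X : Type*} (G : SimpleGraph X) (S : Set X) : Prop :=
  BiconnectedSet G S ∧ ∀ T : Set X, BiconnectedSet G T → S ⊆ T → T = S

/-- The induced subgraph on `S` is a cycle of odd length. -/
def OddCycleSet {X : Type*} (G : SimpleGraph X) (S : Set X) : Prop :=
  ∃ n : ℕ, Odd n ∧ 3 ≤ n ∧ Nonempty (G.induce S ≃g SimpleGraph.cycleGraph n)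

/-- A Gallai tree is a connected graph each of whose blocks induces a complete
graph or an odd cycle. -/
def GallaiTree {X : Type*} (G : SimpleGraph X) : Prop :=
  G.Connected ∧ ∀ S : Set X, GraphBlock G S → G.IsClique S ∨ OddCycleSet G S

/-- A graph is ample if every vertex has degree at least 2 and for every vertex `x`,
every connected component of the restriction of `G` to the complement of `{x}`
contains a vertex of degree at least 3 in that restriction. -/
def AmpleGraph {X : Type*} (G : SimpleGraph X) : Prop :=
  (∀ x : X, 2 ≤ (G.neighborSet x).encard) ∧
  ∀ x : X, ∀ y : ({x}ᶜ : Set X), ∃ z : ({x}ᶜ : Set X),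
    (G.induce ({x}ᶜ : Set X)).Reachable y z ∧
      3 ≤ ((G.induce ({x}ᶜ : Set X)).neighborSet z).encard

/-- `x E^even_G y`: `x` and `y` are joined by a path of even length in `G`. -/
def EvenRel {X : Type*} (G : SimpleGraph X) (x y : X) : Prop :=
  ∃ p : G.Walk x y, p.IsPath ∧ Even p.length

/-- A set is `E^even_G`-invariant if it is a union of `E^even_G`-classes. -/
def EvenInvariant {X : Type*} (G : SimpleGraph X) (C : Set X) : Prop :=
  ∀ ⦃x y : X⦄, EvenRel G x y → x ∈ C → y ∈ C

section Novikov

open Set PiNat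

namespace MeasureTheory

variable {α : Type*} [MeasurableSpace α]

/-- The sets `A n` are contained in measurable sets with empty intersection. -/
def JointlySeparable (A : ℕ → Set α) : Prop :=
  ∃ C : ℕ → Set α, (∀ n, A n ⊆ C n) ∧ (∀ n, MeasurableSet (C n)) ∧ ⋂ n, C n = ∅

theorem JointlySeparable.update_iUnion {A D : ℕ → Set α} {i : ℕ} (hA : A i = ⋃ m, D m)
    (h : ∀ m, JointlySeparable (Function.update A i (D m))) : JointlySeparable A := by
  choose C hAC hC hC0 using h
  refine ⟨fun n => if n = i then ⋃ m, C m i else ⋂ m, C m n, fun n => ?_, fun n => ?_, ?_⟩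
  · by_cases hn : n = i
    · subst hn
      simp only [if_true, hA]
      refine iUnion_mono fun m => ?_
      simpa using hAC m n
    · simp only [hn, if_false]
      refine subset_iInter fun m => ?_
      simpa [hn] using hAC m n
  · by_cases hn : n = i
    · simp only [hn, if_true]
      exact MeasurableSet.iUnion fun m => hC m i
    · simp only [hn, if_false]
      exact MeasurableSet.iInter fun m => hC m n
  · rw [eq_empty_iff_forall_notMem]
    intro x hx
    rw [mem_iInter] at hx
    have hi := hx i
    simp only [if_true, mem_iUnion] at hi
    obtain ⟨m, hm⟩ := hi
    have : x ∈ ⋂ n, C m n := by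
      refine mem_iInter.2 fun n => ?_
      by_cases hn : n = i
      · exact hn ▸ hm
      · have hxn := hx n
        simp only [hn, if_false, mem_iInter] at hxn
        exact hxn m
    rw [hC0 m] at this
    exact this

theorem exists_cylinder_subset {U : Set (ℕ → ℕ)} (hU : IsOpen U) {z : ℕ → ℕ} (hz : z ∈ U) :
    ∃ k, PiNat.cylinder z k ⊆ U := by
  obtain ⟨_, ⟨x, k, rfl⟩, hzx, hsub⟩ :=
    (isTopologicalBasis_cylinders (E := fun _ : ℕ => ℕ)).mem_nhds_iff.1 (hU.mem_nhds hz)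
  exact ⟨k, (mem_cylinder_iff_eq.1 hzx) ▸ hsub⟩

theorem jointlySeparable_range [TopologicalSpace α] [T2Space α] [OpensMeasurableSpace α]
    {f : ℕ → (ℕ → ℕ) → α} (hf : ∀ n, Continuous (f n)) (h : ⋂ n, range (f n) = ∅) :
    JointlySeparable fun n => range (f n) := by
  by_contra hsep
  have refine_one : ∀ (i : ℕ) (s : ℕ → ℕ → ℕ) (l : ℕ → ℕ),
      ¬ JointlySeparable (fun n => f n '' PiNat.cylinder (s n) (l n)) →
      ∃ s' : ℕ → ℕ → ℕ, (∀ n, s' n ∈ PiNat.cylinder (s n) (l n)) ∧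
        ¬ JointlySeparable
          (fun n => f n '' PiNat.cylinder (s' n) (Function.update l i (l i + 1) n)) := by
    intro i s l hsl
    by_contra hcon
    push Not at hcon
    refine hsl (JointlySeparable.update_iUnion (i := i)
      (D := fun m => f i '' PiNat.cylinder (Function.update (s i) (l i) m) (l i + 1)) ?_
        fun m => ?_)
    · rw [← image_iUnion]
      exact congrArg _ (iUnion_cylinder_update (E := fun _ => ℕ) (s i) (l i)).symm
    · convert! hcon (Function.update s i (Function.update (s i) (l i) m)) ?_ using 1
      · ext1 n
        by_cases hn : n = i
        · subst hn; simp
        · simp [hn]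
      · intro n
        by_cases hn : n = i
        · subst hn; simpa using update_mem_cylinder _ _ _
        · simp [hn]
  let P := {p : (ℕ → ℕ → ℕ) × (ℕ → ℕ) //
    ¬ JointlySeparable (fun n => f n '' PiNat.cylinder (p.1 n) (p.2 n))}
  have next : ∀ (i : ℕ) (p : P), ∃ q : P, q.1.2 = Function.update p.1.2 i (p.1.2 i + 1) ∧
      ∀ n, q.1.1 n ∈ PiNat.cylinder (p.1.1 n) (p.1.2 n) := by
    intro i p
    obtain ⟨s', h₁, h₂⟩ := refine_one i p.1.1 p.1.2 p.2
    exact ⟨⟨⟨s', _⟩, h₂⟩, rfl, h₁⟩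
  choose F hFl hFs using next
  let p0 : P := ⟨⟨fun _ _ => 0, fun _ => 0⟩, by simpa using hsep⟩
  let p : ℕ → P := fun t => Nat.rec p0 (fun t q => F (Nat.unpair t).1 q) t
  have hp : ∀ t, p (t + 1) = F (Nat.unpair t).1 (p t) := fun t => rfl
  have hlmono : ∀ n, Monotone fun t => (p t).1.2 n := by
    intro n
    refine monotone_nat_of_le_succ fun t => ?_
    simp only [hp, hFl]
    by_cases hn : n = (Nat.unpair t).1
    · subst hn; simp
    · simp [hn]
  have hlbig : ∀ n k, ∃ t, k < (p t).1.2 n := by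
    intro n k
    suffices k < (p (Nat.pair n k + 1)).1.2 n from
      ⟨Nat.pair n k + 1, this⟩
    induction k with
    | zero => simp [hp, hFl]
    | succ k ih =>
      have h₁ : Nat.pair n k + 1 ≤ Nat.pair n (k + 1) :=
        Nat.pair_lt_pair_right n (Nat.lt_succ_self k)
      have h₂ := hlmono n h₁
      simp only at h₂
      have h₃ : (p (Nat.pair n (k + 1) + 1)).1.2 n = (p (Nat.pair n (k + 1))).1.2 n + 1 := by
        simp [hp, hFl]
      omega
  have hs : ∀ n t t', t ≤ t' → (p t').1.1 n ∈ PiNat.cylinder ((p t).1.1 n) ((p t).1.2 n) := by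
    intro n t
    refine Nat.le_induction (self_mem_cylinder _ _) fun t' htt' ih => ?_
    intro k hk
    have h₁ := hFs (Nat.unpair t').1 (p t') n k (lt_of_lt_of_le hk (hlmono n htt'))
    rw [hp, h₁]
    exact ih k hk
  choose T hT using hlbig
  let z : ℕ → ℕ → ℕ := fun n k => (p (T n k)).1.1 n k
  have hz : ∀ n t, z n ∈ PiNat.cylinder ((p t).1.1 n) ((p t).1.2 n) := by
    intro n t k hk
    rw [← hs n t _ (le_max_left t (T n k)) k hk]
    exact (hs n (T n k) _ (le_max_right t (T n k)) k (hT n k)).symm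
  obtain ⟨i, j, hij⟩ : ∃ i j, f i (z i) ≠ f j (z j) := by
    by_contra hcon
    push Not at hcon
    have : f 0 (z 0) ∈ ⋂ n, range (f n) := mem_iInter.2 fun n => ⟨z n, hcon n 0⟩
    rw [h] at this
    exact this
  obtain ⟨u, v, hu, hv, hiu, hjv, huv⟩ := t2_separation hij
  obtain ⟨k, hk⟩ := exists_cylinder_subset (hu.preimage (hf i)) hiu
  obtain ⟨k', hk'⟩ := exists_cylinder_subset (hv.preimage (hf j)) hjv
  let t := max (T i k) (T j k')
  have hi : f i '' PiNat.cylinder ((p t).1.1 i) ((p t).1.2 i) ⊆ u := by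
    rw [← mem_cylinder_iff_eq.1 (hz i t), image_subset_iff]
    exact (cylinder_anti _ ((hT i k).le.trans (hlmono i (le_max_left _ _)))).trans hk
  have hj : f j '' PiNat.cylinder ((p t).1.1 j) ((p t).1.2 j) ⊆ v := by
    rw [← mem_cylinder_iff_eq.1 (hz j t), image_subset_iff]
    exact (cylinder_anti _ ((hT j k').le.trans (hlmono j (le_max_right _ _)))).trans hk'
  have hne : i ≠ j := by
    rintro rfl
    exact hij rfl
  refine (p t).2 ⟨fun n => if n = i then u else if n = j then v else univ,
    fun n => ?_, fun n => ?_, ?_⟩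
  · by_cases hni : n = i
    · subst hni; simpa using hi
    · by_cases hnj : n = j
      · subst hnj; simpa [hni] using hj
      · simp [hni, hnj]
  · simp only
    split_ifs
    exacts [hu.measurableSet, hv.measurableSet, MeasurableSet.univ]
  · rw [eq_empty_iff_forall_notMem]
    intro x hx
    rw [mem_iInter] at hx
    have h₁ := hx i
    have h₂ := hx j
    simp only [if_true] at h₁
    simp only [if_true, if_neg hne.symm] at h₂
    exact disjoint_left.1 huv h₁ h₂

/-- **Novikov's separation theorem**: countably many analytic sets with empty intersection are
contained in measurable sets with empty intersection. -/
theorem jointlySeparable_of_analyticSet [TopologicalSpace α] [T2Space α] [OpensMeasurableSpace α]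
    {A : ℕ → Set α} (hA : ∀ n, AnalyticSet (A n)) (h : ⋂ n, A n = ∅) : JointlySeparable A := by
  by_cases hne : ∃ n, A n = ∅
  · obtain ⟨n, hn⟩ := hne
    refine ⟨fun k => if k = n then ∅ else univ, fun k => ?_, fun k => ?_, ?_⟩
    · by_cases hk : k = n
      · simp [hk, hn]
      · simp [hk]
    · simp only
      split_ifs
      exacts [MeasurableSet.empty, MeasurableSet.univ]
    · exact eq_empty_of_forall_notMem fun x hx => by simpa using mem_iInter.1 hx n
  · push Not at hne
    have : ∀ n, ∃ f : (ℕ → ℕ) → α, Continuous f ∧ range f = A n := fun n => by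
      have hAn := hA n
      rw [AnalyticSet] at hAn
      rcases hAn with h | h
      · exact absurd h (hne n).ne_empty
      · exact h
    choose f hf hfA using this
    obtain rfl : (fun n => range (f n)) = A := funext hfA
    exact jointlySeparable_range hf h

end MeasureTheory

end Novikov

section Enumeration

open Set TopologicalSpace

variable {X : Type*}

/-- A sequence of measurable sets separating points from finite sets. -/
theorem exists_measurableSet_separating (X : Type*) [TopologicalSpace X] [SecondCountableTopology X]
    [T1Space X] [MeasurableSpace X] [OpensMeasurableSpace X] :
    ∃ V : ℕ → Set X, (∀ n, MeasurableSet (V n)) ∧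
      ∀ (a : X) (F : Set X), F.Finite → a ∉ F → ∃ n, a ∈ V n ∧ ∀ b ∈ F, b ∉ V n := by
  obtain ⟨V, hV⟩ := ((countable_countableBasis X).insert ∅).exists_eq_range (insert_nonempty _ _)
  refine ⟨V, fun n => ?_, fun a F hF ha => ?_⟩
  · have : V n ∈ insert ∅ (countableBasis X) := hV ▸ mem_range_self n
    rcases this with h | h
    · rw [h]; exact MeasurableSet.empty
    · exact (isOpen_of_mem_countableBasis h).measurableSet
  · obtain ⟨W, hW, haW, hsub⟩ := (isBasis_countableBasis X).exists_subset_of_mem_open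
      (show a ∈ Fᶜ from ha) hF.isClosed.isOpen_compl
    obtain ⟨n, rfl⟩ : W ∈ range V := hV ▸ mem_insert_of_mem _ hW
    exact ⟨n, haW, fun b hb hbW => hsub hbW hb⟩

variable [MeasurableSpace X]

/-- A locally finite Borel graph is covered by the graphs of countably many Borel functions. -/
theorem exists_measurable_neighbor_enum [TopologicalSpace X] [PolishSpace X] [BorelSpace X]
    {G : SimpleGraph X} (hG : MeasurableSet {p : X × X | G.Adj p.1 p.2})
    (hlf : ∀ x, (G.neighborSet x).Finite) :
    ∃ g : ℕ → X → X, (∀ n, Measurable (g n)) ∧ (∀ n x, g n x = x ∨ G.Adj x (g n x)) ∧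
      ∀ x y, G.Adj x y → ∃ n, g n x = y := by
  classical
  obtain ⟨V, hVm, hV⟩ := exists_measurableSet_separating X
  let P : ℕ → Set ((X × X) × X) := fun n =>
    {q | G.Adj q.1.1 q.1.2 ∧ G.Adj q.1.1 q.2 ∧ (q.1.2 ∈ V n → q.2 ∈ V n ∧ q.1.2 ≠ q.2)}
  have hP : ∀ n, MeasurableSet (P n) := by
    intro n
    have h₁ : MeasurableSet {q : (X × X) × X | G.Adj q.1.1 q.1.2} := measurable_fst hG
    have h₂ : MeasurableSet {q : (X × X) × X | G.Adj q.1.1 q.2} :=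
      (measurable_fst.fst.prodMk measurable_snd) hG
    have h₃ : MeasurableSet {q : (X × X) × X | q.1.2 ∈ V n} := measurable_fst.snd (hVm n)
    have h₄ : MeasurableSet {q : (X × X) × X | q.2 ∈ V n} := measurable_snd (hVm n)
    have h₅ : MeasurableSet {q : (X × X) × X | q.1.2 = q.2} :=
      measurableSet_eq_fun measurable_fst.snd measurable_snd
    exact h₁.inter (h₂.inter (h₃.imp (h₄.inter h₅.compl)))
  have hQ : ∀ n, AnalyticSet (Prod.fst '' P n) := fun n => (hP n).analyticSet_image measurable_fst
  have hQ0 : ⋂ n, Prod.fst '' P n = ∅ := by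
    refine eq_empty_of_forall_notMem fun q hq => ?_
    rw [mem_iInter] at hq
    obtain ⟨⟨⟨x, y⟩, _⟩, ⟨hadj, -, -⟩, rfl⟩ := hq 0
    obtain ⟨n, hyn, hn⟩ := hV y (G.neighborSet x \ {y}) ((hlf x).sdiff) (by simp)
    obtain ⟨⟨_, y'⟩, ⟨-, hadj', himp⟩, rfl⟩ := hq n
    exact hn y' ⟨hadj', fun h => (himp hyn).2 h.symm⟩ (himp hyn).1
  obtain ⟨C, hQC, hCm, hC0⟩ := jointlySeparable_of_analyticSet hQ hQ0
  let E : ℕ → Set (X × X) := fun n => {p | G.Adj p.1 p.2} \ C n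
  have hE : ∀ n, MeasurableSet (E n) := fun n => hG.diff (hCm n)
  have hinj : ∀ n x y y', (x, y) ∈ E n → (x, y') ∈ E n → y = y' := by
    intro n x y y' h h'
    have key : ∀ z z', (x, z) ∈ E n → (x, z') ∈ E n → z ∈ V n ∧ (z' ∈ V n → z = z') := by
      intro z z' hz hz'
      have hzQ : (x, z) ∉ Prod.fst '' P n := fun hcon => hz.2 (hQC n hcon)
      have hzV : z ∈ V n := by
        by_contra hcon
        exact hzQ ⟨((x, z), z), ⟨hz.1, hz.1, fun h => absurd h hcon⟩, rfl⟩
      refine ⟨hzV, fun hz'V => ?_⟩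
      by_contra hne
      exact hzQ ⟨((x, z), z'), ⟨hz.1, hz'.1, fun _ => ⟨hz'V, hne⟩⟩, rfl⟩
    exact (key y y' h h').2 (key y' y h' h).1
  have himage : ∀ n (W : Set (X × X)), MeasurableSet W →
      MeasurableSet (Prod.fst '' (E n ∩ W)) := by
    intro n W hW
    refine ((hE n).inter hW).image_of_measurable_injOn measurable_fst ?_
    rintro ⟨x, y⟩ h ⟨x', y'⟩ h' (rfl : x = x')
    rw [hinj n x y y' h.1 h'.1]
  let g : ℕ → X → X := fun n x => if h : ∃ y, (x, y) ∈ E n then h.choose else x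
  have hg : ∀ n x y, (x, y) ∈ E n → g n x = y := by
    intro n x y hxy
    have hex : ∃ y, (x, y) ∈ E n := ⟨y, hxy⟩
    simp only [g, dif_pos hex]
    exact hinj n x _ _ hex.choose_spec hxy
  refine ⟨g, fun n W hW => ?_, fun n x => ?_, fun x y hxy => ?_⟩
  · have : g n ⁻¹' W = Prod.fst '' (E n ∩ Prod.snd ⁻¹' W) ∪
        (W \ Prod.fst '' (E n ∩ univ)) := by
      ext x
      by_cases hex : ∃ y, (x, y) ∈ E n
      · obtain ⟨y, hy⟩ := hex
        simp only [mem_preimage, hg n x y hy, inter_univ, mem_union, mem_sdiff, mem_image,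
          Prod.exists, exists_and_right, exists_eq_right, mem_inter_iff]
        constructor
        · exact fun h => Or.inl ⟨y, hy, h⟩
        · rintro (⟨y', hy', h⟩ | ⟨-, h⟩)
          · exact hinj n x y y' hy hy' ▸ h
          · exact absurd ⟨y, hy⟩ h
      · have hgx : g n x = x := by simp only [g, dif_neg hex]
        simp only [mem_preimage, hgx, inter_univ, mem_union, mem_sdiff, mem_image,
          Prod.exists, exists_and_right, exists_eq_right, mem_inter_iff]
        constructor
        · exact fun h => Or.inr ⟨h, hex⟩
        · rintro (⟨y', hy', h⟩ | ⟨h, -⟩)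
          · exact absurd ⟨y', hy'⟩ hex
          · exact h
    rw [this]
    exact (himage n _ (measurable_snd hW)).union (hW.diff (himage n _ MeasurableSet.univ))
  · by_cases hex : ∃ y, (x, y) ∈ E n
    · obtain ⟨y, hy⟩ := hex
      rw [hg n x y hy]
      exact Or.inr hy.1
    · exact Or.inl (by simp only [g, dif_neg hex])
  · obtain ⟨n, hn⟩ : ∃ n, (x, y) ∉ C n := by
      by_contra hcon
      push Not at hcon
      have : (x, y) ∈ ⋂ n, C n := mem_iInter.2 hcon
      rw [hC0] at this
      exact this
    exact ⟨n, hg n x y ⟨hxy, hn⟩⟩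

/-- The functions `h n` are measurable and enumerate the components of `G`. -/
structure EnumeratesComponents (G : SimpleGraph X) (h : ℕ → X → X) : Prop where
  measurable : ∀ n, Measurable (h n)
  reachable_iff : ∀ x y, G.Reachable x y ↔ ∃ n, h n x = y

theorem exists_enumeratesComponents [TopologicalSpace X] [PolishSpace X] [BorelSpace X]
    {G : SimpleGraph X} (hG : MeasurableSet {p : X × X | G.Adj p.1 p.2})
    (hlf : ∀ x, (G.neighborSet x).Finite) : ∃ h, EnumeratesComponents G h := by
  obtain ⟨g, hgm, hg, hgs⟩ := exists_measurable_neighbor_enum hG hlf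
  let w : List ℕ → X → X := fun l x => l.foldl (fun y n => g n y) x
  have hwm : ∀ l, Measurable (w l) := by
    intro l
    induction l with
    | nil => exact measurable_id
    | cons n l ih => exact ih.comp (hgm n)
  have hwr : ∀ l x, G.Reachable x (w l x) := by
    intro l
    induction l with
    | nil => exact fun x => SimpleGraph.Reachable.refl x
    | cons n l ih =>
      intro x
      have h₁ : G.Reachable x (g n x) := by
        rcases hg n x with h | h
        · rw [h]
        · exact h.reachable
      exact h₁.trans (ih (g n x))
  have hws : ∀ {x y} (_ : G.Walk x y), ∃ l, w l x = y := by
    intro x y p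
    induction p with
    | nil => exact ⟨[], rfl⟩
    | @cons x z y hadj q ih =>
      obtain ⟨l, hl⟩ := ih
      obtain ⟨n, hn⟩ := hgs x z hadj
      exact ⟨n :: l, by simp only [w, List.foldl_cons, hn]; exact hl⟩
  refine ⟨fun n => w (Denumerable.ofNat (List ℕ) n), fun n => hwm _, fun x y => ⟨?_, ?_⟩⟩
  · rintro ⟨p⟩
    obtain ⟨l, hl⟩ := hws p
    exact ⟨Encodable.encode l, by simpa using hl⟩
  · rintro ⟨n, rfl⟩
    exact hwr _ x

end Enumeration

namespace SimpleGraph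

variable {V : Type*} {G : SimpleGraph V}

/-- `w` lies on a geodesic from `a` to `v`. -/
def Between (G : SimpleGraph V) (a w v : V) : Prop :=
  G.Reachable a w ∧ G.Reachable w v ∧ G.dist a v = G.dist a w + G.dist w v

theorem Between.reachable {a w v : V} (h : G.Between a w v) : G.Reachable a v := h.1.trans h.2.1

theorem Between.symm {a w v : V} (h : G.Between a w v) : G.Between v w a :=
  ⟨h.2.1.symm, h.1.symm, by have := h.2.2; rw [dist_comm, this, dist_comm, Nat.add_comm,
    dist_comm (u := v)]⟩

theorem Between.trans {a u w v : V} (h₁ : G.Between a u w) (h₂ : G.Between a w v) :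
    G.Between a u v := by
  refine ⟨h₁.1, h₁.2.1.trans h₂.2.1, ?_⟩
  have e₁ := h₁.2.2
  have e₂ := h₂.2.2
  have t₁ := h₁.2.1.dist_triangle_left v
  have t₂ := h₁.1.dist_triangle_left v
  omega

theorem between_self_right {a v : V} (h : G.Reachable a v) : G.Between a v v :=
  ⟨h, Reachable.refl v, by simp⟩

theorem between_self_left {a v : V} (h : G.Reachable a v) : G.Between a a v :=
  ⟨Reachable.refl a, h, by simp⟩

theorem Between.dist_le {a w v : V} (h : G.Between a w v) : G.dist a w ≤ G.dist a v := by
  have := h.2.2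
  omega

/-- A vertex different from `w` has a neighbour closer to `w`. -/
theorem Reachable.exists_adj_dist {w v : V} (h : G.Reachable w v) (hne : w ≠ v) :
    ∃ u, G.Adj v u ∧ G.Reachable w u ∧ G.dist w v = G.dist w u + 1 := by
  obtain ⟨p, hp⟩ := h.symm.exists_walk_length_eq_dist
  cases p with
  | nil => exact absurd rfl hne
  | @cons _ u _ hadj q =>
    refine ⟨u, hadj, q.reachable.symm, ?_⟩
    have h₁ : G.dist u w ≤ q.length := SimpleGraph.dist_le q
    have h₂ := hadj.reachable.dist_triangle_left w
    have h₃ := dist_eq_one_iff_adj.mpr hadj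
    simp only [Walk.length_cons] at hp
    rw [dist_comm (u := w), dist_comm (u := w)]
    omega

/-- In an acyclic graph the neighbour closer to a given vertex is unique. -/
theorem IsAcyclic.eq_of_adj_closer (hG : G.IsAcyclic) {a v u u' : V} (hr : G.Reachable a v)
    (h : G.Adj v u) (h' : G.Adj v u') (hd : G.dist a v = G.dist a u + 1)
    (hd' : G.dist a v = G.dist a u' + 1) : u = u' := by
  obtain ⟨p, hp⟩ := (hr.trans h.reachable).exists_walk_length_eq_dist
  obtain ⟨q, hq⟩ := (hr.trans h'.reachable).exists_walk_length_eq_dist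
  have hp' : (p.concat h.symm).IsPath :=
    Walk.isPath_of_length_eq_dist _ (by simp [hp, hd])
  have hq' : (q.concat h'.symm).IsPath :=
    Walk.isPath_of_length_eq_dist _ (by simp [hq, hd'])
  have e : p.concat h.symm = q.concat h'.symm :=
    congrArg Subtype.val ((hG.subsingleton_path a _).elim ⟨_, hp'⟩ ⟨_, hq'⟩)
  have := congrArg Walk.penultimate e
  simpa using this

/-- Passing from `v ≠ w` to its neighbour closer to `a` stays beyond `w`. -/
theorem IsAcyclic.between_parent (hG : G.IsAcyclic) {a w v u : V} (h : G.Between a w v)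
    (hne : w ≠ v) (hadj : G.Adj v u) (hd : G.dist a v = G.dist a u + 1) : G.Between a w u := by
  obtain ⟨u', hadj', hr', hd'⟩ := h.2.1.exists_adj_dist hne
  have t := h.1.dist_triangle_left u'
  have t₂ := hadj'.symm.reachable.dist_triangle_right a
  have t₃ := dist_eq_one_iff_adj.mpr hadj'.symm
  have e := h.2.2
  have hd'' : G.dist a v = G.dist a u' + 1 := by omega
  obtain rfl := hG.eq_of_adj_closer h.reachable hadj hadj' hd hd''
  exact ⟨h.1, hr', by omega⟩

theorem Between.child {a w v u : V} (h : G.Between a w v) (hadj : G.Adj v u)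
    (hd : G.dist a u = G.dist a v + 1) : G.Between a w u := by
  refine ⟨h.1, h.2.1.trans hadj.reachable, ?_⟩
  have t := h.1.dist_triangle_left u
  have t₂ := h.2.1.dist_triangle_left u
  have t₃ := dist_eq_one_iff_adj.mpr hadj
  have e := h.2.2
  omega

theorem Between.exists_child {a w v : V} (h : G.Between a w v) (hne : w ≠ v) :
    ∃ u, G.Adj w u ∧ G.dist a u = G.dist a w + 1 ∧ G.Between a u v := by
  obtain ⟨u, hadj, hr, hd⟩ := h.2.1.symm.exists_adj_dist hne.symm
  have e := h.2.2
  have t := (h.1.trans hadj.reachable).dist_triangle_left v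
  have t₂ := h.1.dist_triangle_left u
  have t₃ := dist_eq_one_iff_adj.mpr hadj
  rw [dist_comm, dist_comm (u := v)] at hd
  exact ⟨u, hadj, by omega, h.1.trans hadj.reachable, hr.symm, by omega⟩

theorem IsAcyclic.dist_cases (hG : G.IsAcyclic) {a v u : V} (hadj : G.Adj v u)
    (hr : G.Reachable a v) : G.dist a v = G.dist a u + 1 ∨ G.dist a u = G.dist a v + 1 :=
  hG.dist_eq_dist_add_one_of_adj_of_reachable a hadj hr

/-- The only edge leaving the set of vertices beyond `w` is the one at `w`. -/
theorem IsAcyclic.eq_of_between_of_not_between (hG : G.IsAcyclic) {a w s t : V}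
    (hs : G.Between a w s) (ht : ¬ G.Between a w t) (hadj : G.Adj s t) : w = s := by
  by_contra hne
  rcases hG.dist_cases hadj hs.reachable with h | h
  · exact ht (hG.between_parent hs hne hadj h)
  · exact ht (hs.child hadj h)

/-- A geodesic that leaves the set of vertices beyond `w` passes through `w`. -/
theorem IsAcyclic.between_of_not_between (hG : G.IsAcyclic) {a w y x : V}
    (hy : G.Between a w y) (hx : ¬ G.Between a w x) (hr : G.Reachable a x) :
    G.Between y w x := by
  have main : ∀ {s t : V} (p : G.Walk s t), G.Between a w s → ¬ G.Between a w t →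
      G.dist s w + G.dist w t ≤ p.length := by
    intro s t p
    induction p with
    | nil => intro h h'; exact absurd h h'
    | @cons s m t hadj q ih =>
      intro h h'
      by_cases hm : G.Between a w m
      · have := ih hm h'
        have := hadj.reachable.dist_triangle_left w
        have := dist_eq_one_iff_adj.mpr hadj
        simp only [Walk.length_cons]
        omega
      · obtain rfl := hG.eq_of_between_of_not_between h hm hadj
        have := SimpleGraph.dist_le (Walk.cons hadj q)
        simpa using this
  refine ⟨hy.2.1.symm, hy.1.symm.trans hr, ?_⟩
  obtain ⟨p, hp⟩ := (hy.reachable.symm.trans hr).exists_walk_length_eq_dist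
  have := main p hy hx
  have := hy.2.1.symm.dist_triangle_left x
  omega

end SimpleGraph

namespace SimpleGraph

variable {V : Type*} {G : SimpleGraph V}

/-- `x` has at least two neighbours. -/
def TwoNbrs (G : SimpleGraph V) (x : V) : Prop :=
  ∃ y₁ y₂, G.Adj x y₁ ∧ G.Adj x y₂ ∧ y₁ ≠ y₂

/-- `x` has at least three neighbours. -/
def Branch (G : SimpleGraph V) (x : V) : Prop :=
  ∃ y₁ y₂ y₃, G.Adj x y₁ ∧ G.Adj x y₂ ∧ G.Adj x y₃ ∧ y₁ ≠ y₂ ∧ y₁ ≠ y₃ ∧ y₂ ≠ y₃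

/-- The graph on the same vertices whose edges are the edges of `G` with both ends in `S`. -/
def restr (G : SimpleGraph V) (S : Set V) : SimpleGraph V where
  Adj x y := G.Adj x y ∧ x ∈ S ∧ y ∈ S
  symm := ⟨fun _ _ h => ⟨h.1.symm, h.2.2, h.2.1⟩⟩
  loopless := ⟨fun _ h => h.1.ne rfl⟩

theorem restr_le (G : SimpleGraph V) (S : Set V) : G.restr S ≤ G := fun _ _ h => h.1

theorem restr_adj {S : Set V} {x y : V} :
    (G.restr S).Adj x y ↔ G.Adj x y ∧ x ∈ S ∧ y ∈ S := Iff.rfl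

/-- The branch vertex `w ≠ a` has a further branch vertex beyond it, as seen from `a`. -/
def Big (G : SimpleGraph V) (a w : V) : Prop :=
  a ≠ w ∧ G.Branch w ∧ ∃ b, b ≠ w ∧ G.Between a w b ∧ G.Branch b

/-- The vertices that can be reached from `a` without meeting a big vertex. -/
def hull (G : SimpleGraph V) (a : V) : Set V :=
  {v | G.Reachable a v ∧ ∀ w, G.Between a w v → ¬ G.Big a w}

/-- The big vertices next to the hull of `a`. -/
def gate (G : SimpleGraph V) (a : V) : Set V :=
  {w | G.Big a w ∧ ∃ p, G.Adj w p ∧ p ∈ G.hull a}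

/-- All branch vertices of the hull of `a`, and some branch vertex beyond each of its gates,
are within distance `r` of `a`. -/
def HullRadius (G : SimpleGraph V) (r : ℕ) (a : V) : Prop :=
  (∀ b ∈ G.hull a, G.Branch b → G.dist a b ≤ r) ∧
  ∀ w ∈ G.gate a, ∃ w', w' ≠ w ∧ G.Between a w w' ∧ G.Branch w' ∧ G.dist a w' ≤ r

theorem Big.reachable {a w : V} (h : G.Big a w) : G.Reachable a w := by
  obtain ⟨-, -, w', -, h, -⟩ := h
  exact h.1

theorem IsAcyclic.mem_gate_of_adj (hG : G.IsAcyclic) {a u v : V} (hu : u ∈ G.hull a)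
    (hv : v ∉ G.hull a) (hadj : G.Adj u v) :
    v ∈ G.gate a ∧ G.dist a v = G.dist a u + 1 := by
  have hr : G.Reachable a v := hu.1.trans hadj.reachable
  have : ∃ w, G.Between a w v ∧ G.Big a w := by
    by_contra hcon
    exact hv ⟨hr, fun w hw hb => hcon ⟨w, hw, hb⟩⟩
  obtain ⟨w, hw, hb⟩ := this
  have hnu : ¬ G.Between a w u := fun h => hu.2 w h hb
  obtain rfl := hG.eq_of_between_of_not_between hw hnu hadj.symm
  refine ⟨⟨hb, u, hadj.symm, hu⟩, ?_⟩
  rcases hG.dist_cases hadj hu.1 with h | h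
  · exact absurd (hw.child hadj.symm h) hnu
  · exact h

theorem exists_gate {a v : V} (hr : G.Reachable a v)
    (hv : v ∉ G.hull a) : ∃ w ∈ G.gate a, G.Between a w v := by
  classical
  have : ∃ n w, G.Between a w v ∧ G.Big a w ∧ G.dist a w = n := by
    by_contra hcon
    exact hv ⟨hr, fun w hw hb => hcon ⟨_, w, hw, hb, rfl⟩⟩
  obtain ⟨w, hw, hb, hd⟩ := Nat.find_spec this
  obtain ⟨p, hadj, hrp, hdp⟩ := hb.reachable.exists_adj_dist hb.1
  refine ⟨w, ⟨hb, p, hadj, hrp, fun w₀ hw₀ hb₀ => ?_⟩, hw⟩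
  have h₁ : G.Between a w₀ w := hw₀.child hadj.symm hdp
  have h₂ := Nat.find_min' this ⟨w₀, h₁.trans hw, hb₀, rfl⟩
  have h₃ := hw₀.dist_le
  omega

/-- A gate of `a` has no branch vertex strictly between itself and `a`, and neither has a branch
vertex of the hull. -/
theorem IsAcyclic.not_branch_of_between (hG : G.IsAcyclic) {a b c : V}
    (hb : b ∈ G.hull a ∨ b ∈ G.gate a) (hbb : G.Branch b) (hac : a ≠ c) (hcb : c ≠ b)
    (hc : G.Between a c b) : ¬ G.Branch c := by
  intro hbc
  have hbig : G.Big a c := ⟨hac, hbc, b, hcb.symm, hc, hbb⟩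
  rcases hb with hb | ⟨hb, p, hadj, hp⟩
  · exact hb.2 c hc hbig
  · rcases hG.dist_cases hadj hb.reachable with h | h
    · exact hp.2 c (hG.between_parent hc hcb hadj h) hbig
    · exact hp.2 c (hc.child hadj h) hbig

/-- Two branch vertices in the same direction from `a`, neither hidden by another branch vertex,
coincide. -/
theorem IsAcyclic.eq_of_first_branch (hG : G.IsAcyclic) {a y b b' : V}
    (hy : G.dist a y = 1) (hyb : G.Between a y b) (hyb' : G.Between a y b')
    (hbb : G.Branch b)
    (hb : ∀ c, a ≠ c → c ≠ b → G.Between a c b → ¬ G.Branch c)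
    (hb' : ∀ c, a ≠ c → c ≠ b' → G.Between a c b' → ¬ G.Branch c)
    (hle : G.dist a b ≤ G.dist a b') : b = b' := by
  have main : ∀ n u, G.dist a u = n → G.Between a y u → G.Between a u b → G.Between a u b' := by
    intro n
    induction n with
    | zero =>
      intro u hu hyu
      have := hyu.dist_le
      omega
    | succ n ih =>
      intro u hu hyu hub
      by_cases hne : y = u
      · exact hne ▸ hyb'
      have hau : a ≠ u := by rintro rfl; simp at hu
      obtain ⟨u₀, hadj, hr₀, hd₀⟩ := hub.1.exists_adj_dist hau
      have hy₀ : G.Between a y u₀ := hG.between_parent hyu hne hadj hd₀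
      have h₀u : G.Between a u₀ u := (between_self_right hr₀).child hadj.symm hd₀
      have h₀b : G.Between a u₀ b := h₀u.trans hub
      have h₀b' := ih u₀ (by omega) hy₀ h₀b
      have hlt := hub.dist_le
      have hne₀ : u₀ ≠ b := by rintro rfl; omega
      have hne₀' : u₀ ≠ b' := by rintro rfl; omega
      have ha₀ : a ≠ u₀ := by
        rintro rfl
        have := hy₀.dist_le
        rw [dist_self] at this
        omega
      have hnb := hb u₀ ha₀ hne₀ h₀b
      obtain ⟨u₁, hadj₁, hd₁, hb₁⟩ := h₀b'.exists_child hne₀'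
      obtain ⟨p, hadjp, hrp, hdp⟩ := hr₀.exists_adj_dist ha₀
      have : u = u₁ := by
        by_contra hne₁
        refine hnb ⟨p, u, u₁, hadjp, hadj.symm, hadj₁, ?_, ?_, hne₁⟩
        · rintro rfl; omega
        · rintro rfl; omega
      exact this ▸ hb₁
  have hbb' := main _ b rfl hyb (between_self_right hyb.reachable)
  by_contra hne
  refine hb' b ?_ hne hbb' hbb
  rintro rfl
  have := hyb.dist_le
  rw [dist_self] at this
  omega

theorem IsAcyclic.exists_hullRadius (hG : G.IsAcyclic) {a : V} (hlf : (G.neighborSet a).Finite) :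
    ∃ r, G.HullRadius r a := by
  classical
  have key : ∀ y, G.Adj a y → ∃ r, ∀ b, G.Between a y b → G.Branch b →
      (b ∈ G.hull a → G.dist a b ≤ r) ∧
      (b ∈ G.gate a → ∃ w', w' ≠ b ∧ G.Between a b w' ∧ G.Branch w' ∧ G.dist a w' ≤ r) := by
    intro y hy
    have hy1 := dist_eq_one_iff_adj.mpr hy
    by_cases hex : ∃ b, G.Between a y b ∧ G.Branch b ∧ (b ∈ G.hull a ∨ b ∈ G.gate a)
    · obtain ⟨b, hyb, hbb, hb⟩ := hex
      have hw : ∃ r, b ∈ G.gate a →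
          ∃ w', w' ≠ b ∧ G.Between a b w' ∧ G.Branch w' ∧ G.dist a w' ≤ r := by
        by_cases hbg : b ∈ G.gate a
        · obtain ⟨w', h₁, h₂, h₃⟩ := hbg.1.2.2
          exact ⟨G.dist a w', fun _ => ⟨w', h₁, h₂, h₃, le_rfl⟩⟩
        · exact ⟨0, fun h => absurd h hbg⟩
      obtain ⟨r, hr⟩ := hw
      refine ⟨max r (G.dist a b), fun b' hyb' hbb' => ?_⟩
      have heq : b' ∈ G.hull a ∨ b' ∈ G.gate a → b' = b := by
        intro hb'
        have h₁ := fun c => hG.not_branch_of_between hb hbb (c := c)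
        have h₂ := fun c => hG.not_branch_of_between hb' hbb' (c := c)
        rcases le_total (G.dist a b) (G.dist a b') with hle | hle
        · exact (hG.eq_of_first_branch hy1 hyb hyb' hbb h₁ h₂ hle).symm
        · exact hG.eq_of_first_branch hy1 hyb' hyb hbb' h₂ h₁ hle
      constructor
      · intro h
        rw [heq (Or.inl h)]
        exact le_max_right _ _
      · intro h
        obtain rfl := heq (Or.inr h)
        obtain ⟨w', h₁, h₂, h₃, h₄⟩ := hr h
        exact ⟨w', h₁, h₂, h₃, h₄.trans (le_max_left _ _)⟩
    · exact ⟨0, fun b hyb hbb => ⟨fun h => absurd ⟨b, hyb, hbb, Or.inl h⟩ hex,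
        fun h => absurd ⟨b, hyb, hbb, Or.inr h⟩ hex⟩⟩
  choose! r hr using key
  have hbdd : ∃ N, ∀ y, G.Adj a y → r y ≤ N := by
    obtain ⟨N, hN⟩ := (hlf.image r).bddAbove
    exact ⟨N, fun y hy => hN ⟨y, hy, rfl⟩⟩
  obtain ⟨N, hN⟩ := hbdd
  have dir : ∀ b, a ≠ b → G.Reachable a b → ∃ y, G.Adj a y ∧ G.Between a y b := by
    intro b hne hrb
    obtain ⟨y, h₁, -, h₂⟩ := (between_self_left hrb).exists_child hne
    exact ⟨y, h₁, h₂⟩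
  refine ⟨N, fun b hb hbb => ?_, fun w hw => ?_⟩
  · by_cases hne : a = b
    · simp [hne]
    · obtain ⟨y, hy, hyb⟩ := dir b hne hb.1
      exact ((hr y hy b hyb hbb).1 hb).trans (hN y hy)
  · obtain ⟨y, hy, hyw⟩ := dir w hw.1.1 hw.1.reachable
    obtain ⟨w', h₁, h₂, h₃, h₄⟩ := (hr y hy w hyw hw.1.2.1).2 hw
    exact ⟨w', h₁, h₂, h₃, h₄.trans (hN y hy)⟩

theorem HullRadius.dist_gate_le {r : ℕ} {a w : V} (h : G.HullRadius r a) (hw : w ∈ G.gate a) :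
    G.dist a w ≤ r := by
  obtain ⟨w', -, hb, -, hd⟩ := h.2 w hw
  exact hb.dist_le.trans hd

theorem IsAcyclic.disjoint_hull (hG : G.IsAcyclic) {r : ℕ} {a a' : V} (hr : G.HullRadius r a)
    (ha : G.Branch a) (ha' : G.Branch a') (hd : r < G.dist a a') :
    Disjoint (G.hull a) (G.hull a') := by
  rw [Set.disjoint_left]
  intro v hv hv'
  have hreach : G.Reachable a a' := hv.1.trans hv'.1.symm
  have hna' : a' ∉ G.hull a := fun h => by have := hr.1 a' h ha'; omega
  obtain ⟨w, hw, hwa'⟩ := exists_gate hreach hna'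
  have hdw := hr.dist_gate_le hw
  have hnv : ¬ G.Between a w v := fun h => hv.2 w h hw.1
  have hbw := hG.between_of_not_between hwa' hnv hv.1
  refine hv'.2 w hbw ⟨?_, hw.1.2.1, a, hw.1.1, hwa'.symm, ha⟩
  rintro rfl
  omega

/-- A vertex belongs to the hull of any branch vertex closest to it. -/
theorem exists_mem_hull {v b : V} (hb : G.Branch b) (hr : G.Reachable v b) :
    ∃ a, G.Branch a ∧ v ∈ G.hull a := by
  classical
  have : ∃ n a, G.Branch a ∧ G.Reachable a v ∧ G.dist a v = n := ⟨_, b, hb, hr.symm, rfl⟩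
  obtain ⟨a, ha, hra, hd⟩ := Nat.find_spec this
  refine ⟨a, ha, hra, fun w hw hbig => ?_⟩
  have h₁ := Nat.find_min' this ⟨w, hbig.2.1, hw.2.1, rfl⟩
  have h₂ := hw.2.2
  have h₃ := hw.1.pos_dist_of_ne hbig.1
  omega

/-- A set of branch vertices of bounded hull radius that are far apart. -/
structure Spread (G : SimpleGraph V) (r : ℕ) (A : Set V) : Prop where
  branch : ∀ a ∈ A, G.Branch a
  radius : ∀ a ∈ A, G.HullRadius r a
  far : ∀ a ∈ A, ∀ a' ∈ A, a ≠ a' → G.Reachable a a' → 2 * r + 1 < G.dist a a'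

theorem Spread.eq_of_mem_hull {r : ℕ} {A : Set V} (hA : G.Spread r A) (hG : G.IsAcyclic)
    {a a' v : V} (ha : a ∈ A) (ha' : a' ∈ A) (hv : v ∈ G.hull a) (hv' : v ∈ G.hull a') :
    a = a' := by
  by_contra hne
  have := hA.far a ha a' ha' hne (hv.1.trans hv'.1.symm)
  exact Set.disjoint_left.1 (hG.disjoint_hull (hA.radius a ha) (hA.branch a ha)
    (hA.branch a' ha') (by omega)) hv hv'

theorem Spread.eq_of_dist_le {r : ℕ} {A : Set V} (hA : G.Spread r A)
    {a a' v : V} (ha : a ∈ A) (ha' : a' ∈ A) (hv : G.Reachable a v) (hv' : G.Reachable a' v)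
    (hd : G.dist a v + G.dist a' v ≤ 2 * r + 1) : a = a' := by
  by_contra hne
  have := hA.far a ha a' ha' hne (hv.trans hv'.symm)
  have := hv.dist_triangle_left a'
  rw [dist_comm (u := v)] at this
  omega

/-- Following edges away from the centres of the hulls of a spread set is one-ended. -/
theorem Spread.not_exists_chain {r : ℕ} {A : Set V} (hA : G.Spread r A) (hG : G.IsAcyclic)
    {f : V → V}
    (hf : ∀ a ∈ A, ∀ v ∈ G.hull a, G.Adj v (f v) ∧ G.dist a (f v) = G.dist a v + 1) :
    ¬ ∃ u : ℕ → V, ∀ i, (∃ a ∈ A, u i ∈ G.hull a) ∧ f (u (i + 1)) = u i := by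
  rintro ⟨u, hu⟩
  obtain ⟨⟨a, ha, hua⟩, -⟩ := hu 0
  have main : ∀ i, u i ∈ G.hull a ∧ G.dist a (u i) + i = G.dist a (u 0) := by
    intro i
    induction i with
    | zero => exact ⟨hua, by simp⟩
    | succ i ih =>
      obtain ⟨a', ha', hua'⟩ := (hu (i + 1)).1
      have he := (hu i).2
      have hfa := hf a' ha' _ hua'
      rw [he] at hfa
      have heq : a' = a := by
        by_contra hne
        have hn₁ : u (i + 1) ∉ G.hull a := fun h => hne (hA.eq_of_mem_hull hG ha' ha hua' h)
        have hn₂ : u i ∉ G.hull a' := fun h => hne (hA.eq_of_mem_hull hG ha' ha h ih.1)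
        have g₁ := hG.mem_gate_of_adj ih.1 hn₁ hfa.1.symm
        have g₂ := hG.mem_gate_of_adj hua' hn₂ hfa.1
        have d₁ := (hA.radius a ha).dist_gate_le g₁.1
        have d₂ := (hA.radius a' ha').dist_gate_le g₂.1
        exact hne (hA.eq_of_dist_le ha' ha hua'.1 (ih.1.1.trans hfa.1.symm.reachable)
          (by omega))
      subst heq
      exact ⟨hua', by omega⟩
  have := (main (G.dist a (u 0) + 1)).2
  omega

/-- In `G.restr S` every vertex of `S` has two neighbours and is connected to a branch vertex. -/
def Bushy (G : SimpleGraph V) (S : Set V) : Prop :=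
  ∀ x ∈ S, (G.restr S).TwoNbrs x ∧ ∃ b, (G.restr S).Reachable x b ∧ (G.restr S).Branch b

theorem Spread.bushy {r : ℕ} {A S : Set V} (hA : (G.restr S).Spread r A) (hG : G.IsAcyclic)
    (hS : G.Bushy S) : G.Bushy (S \ {v | ∃ a ∈ A, v ∈ (G.restr S).hull a}) := by
  have hΓ : (G.restr S).IsAcyclic := hG.anti (restr_le G S)
  have hsub : G.restr (S \ {v | ∃ a ∈ A, v ∈ (G.restr S).hull a}) =
      (G.restr S).restr (S \ {v | ∃ a ∈ A, v ∈ (G.restr S).hull a}) := by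
    ext x y
    simp only [restr_adj]
    constructor
    · rintro ⟨h, h₁, h₂⟩; exact ⟨⟨h, h₁.1, h₂.1⟩, h₁, h₂⟩
    · rintro ⟨h, h₁, h₂⟩; exact ⟨h.1, h₁, h₂⟩
  rw [Bushy, hsub]
  set Γ := G.restr S with hΓdef
  set S' := S \ {v | ∃ a ∈ A, v ∈ Γ.hull a} with hS'
  have lost : ∀ v ∈ S', ∀ u, Γ.Adj v u → u ∉ S' →
      ∃ a ∈ A, v ∈ Γ.gate a ∧ Γ.dist a v = Γ.dist a u + 1 := by
    intro v hv u hadj hu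
    have : ∃ a ∈ A, u ∈ Γ.hull a := by
      by_contra hcon
      exact hu ⟨hadj.2.2, hcon⟩
    obtain ⟨a, ha, hua⟩ := this
    exact ⟨a, ha, hΓ.mem_gate_of_adj hua (fun h => hv.2 ⟨a, ha, h⟩) hadj.symm⟩
  have gate_eq : ∀ v, ∀ a ∈ A, ∀ a' ∈ A, v ∈ Γ.gate a → Γ.Reachable a' v → Γ.dist a' v ≤ r →
      a = a' := by
    intro v a ha a' ha' hv hr' hd'
    have := (hA.radius a ha).dist_gate_le hv
    exact hA.eq_of_dist_le ha ha' hv.1.reachable hr' (by omega)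
  have lost_unique : ∀ v ∈ S', ∀ u u', Γ.Adj v u → Γ.Adj v u' → u ∉ S' → u' ∉ S' → u = u' := by
    intro v hv u u' hadj hadj' hu hu'
    obtain ⟨a, ha, hva, hd⟩ := lost v hv u hadj hu
    obtain ⟨a', ha', hva', hd'⟩ := lost v hv u' hadj' hu'
    obtain rfl := gate_eq v a ha a' ha' hva hva'.1.reachable
      ((hA.radius a' ha').dist_gate_le hva')
    exact hΓ.eq_of_adj_closer hva.1.reachable hadj hadj' hd hd'
  have adj' : ∀ v ∈ S', ∀ u ∈ S', Γ.Adj v u → (Γ.restr S').Adj v u :=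
    fun v hv u hu h => ⟨h, hv, hu⟩
  have branch' : ∀ v ∈ S', Γ.Branch v → (∀ a ∈ A, v ∉ Γ.gate a) → (Γ.restr S').Branch v := by
    intro v hv hb hng
    obtain ⟨y₁, y₂, y₃, h₁, h₂, h₃, hne⟩ := hb
    have keep : ∀ u, Γ.Adj v u → u ∈ S' := by
      intro u hadj
      by_contra hu
      obtain ⟨a, ha, hva, -⟩ := lost v hv u hadj hu
      exact hng a ha hva
    exact ⟨y₁, y₂, y₃, adj' v hv _ (keep _ h₁) h₁, adj' v hv _ (keep _ h₂) h₂,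
      adj' v hv _ (keep _ h₃) h₃, hne⟩
  have from_gate : ∀ t ∈ S', ∀ a ∈ A, t ∈ Γ.gate a →
      ∃ b, (Γ.restr S').Reachable t b ∧ (Γ.restr S').Branch b := by
    intro t ht a ha hta
    have beyond : ∀ n u, Γ.dist a u = n → Γ.Between a t u → Γ.dist a u ≤ r →
        u ∈ S' ∧ (Γ.restr S').Reachable t u := by
      intro n
      induction n with
      | zero =>
        intro u hu htu _
        have h₁ := htu.dist_le
        have h₂ := hta.1.reachable.pos_dist_of_ne hta.1.1
        omega
      | succ n ih =>
        intro u hu htu hd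
        by_cases hne : t = u
        · subst hne
          exact ⟨ht, Reachable.refl _⟩
        have hau : a ≠ u := by
          rintro rfl
          simp at hu
        obtain ⟨u₀, hadj, hr₀, hd₀⟩ := htu.reachable.exists_adj_dist hau
        obtain ⟨hu₀, hreach⟩ := ih u₀ (by omega)
          (hΓ.between_parent htu hne hadj hd₀) (by omega)
        have hu' : u ∈ S' := by
          by_contra hcon
          obtain ⟨a', ha', hga', hd'⟩ := lost u₀ hu₀ u hadj.symm hcon
          obtain rfl := gate_eq u₀ a' ha' a ha hga' hr₀ (by omega)
          omega
        exact ⟨hu', hreach.trans (adj' _ hu₀ _ hu' hadj.symm).reachable⟩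
    obtain ⟨w', hne, hbt, hbr, hd⟩ := (hA.radius a ha).2 t hta
    obtain ⟨hw', hreach⟩ := beyond _ w' rfl hbt hd
    refine ⟨w', hreach, branch' w' hw' hbr fun a' ha' hga' => ?_⟩
    obtain rfl := gate_eq w' a' ha' a ha hga' hbt.reachable hd
    exact hΓ.not_branch_of_between (Or.inr hga') hbr hta.1.1 hne.symm hbt hta.1.2.1
  intro x hx
  constructor
  · by_cases hg : ∃ u, Γ.Adj x u ∧ u ∉ S'
    · obtain ⟨u, hu, hu'⟩ := hg
      obtain ⟨a, ha, hga, -⟩ := lost x hx u hu hu'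
      obtain ⟨y₁, y₂, y₃, h₁, h₂, h₃, n₁₂, n₁₃, n₂₃⟩ := hga.1.2.1
      have keep : ∀ y, Γ.Adj x y → y ≠ u → y ∈ S' := by
        intro y hy hne
        by_contra hcon
        exact hne (lost_unique x hx y u hy hu hcon hu')
      by_cases e₁ : y₁ = u
      · exact ⟨y₂, y₃, adj' x hx _ (keep _ h₂ (by rintro rfl; exact n₁₂ e₁)) h₂,
          adj' x hx _ (keep _ h₃ (by rintro rfl; exact n₁₃ e₁)) h₃, n₂₃⟩
      by_cases e₂ : y₂ = u
      · exact ⟨y₁, y₃, adj' x hx _ (keep _ h₁ e₁) h₁,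
          adj' x hx _ (keep _ h₃ (by rintro rfl; exact n₂₃ e₂)) h₃, n₁₃⟩
      · exact ⟨y₁, y₂, adj' x hx _ (keep _ h₁ e₁) h₁, adj' x hx _ (keep _ h₂ e₂) h₂, n₁₂⟩
    · push Not at hg
      obtain ⟨y₁, y₂, h₁, h₂, hne⟩ := (hS x hx.1).1
      exact ⟨y₁, y₂, adj' x hx _ (hg _ h₁) h₁, adj' x hx _ (hg _ h₂) h₂, hne⟩
  · obtain ⟨b, ⟨p⟩, hb⟩ := (hS x hx.1).2
    have walk : ∀ {s t : V} (p : Γ.Walk s t), s ∈ S' → Γ.Branch t →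
        ∃ b, (Γ.restr S').Reachable s b ∧ (Γ.restr S').Branch b := by
      intro s t p
      induction p with
      | @nil s =>
        intro hs ht
        by_cases hg : ∃ a ∈ A, s ∈ Γ.gate a
        · obtain ⟨a, ha, hga⟩ := hg
          exact from_gate _ hs a ha hga
        · push Not at hg
          exact ⟨_, Reachable.refl _, branch' _ hs ht hg⟩
      | @cons s m t hadj q ih =>
        intro hs ht
        by_cases hm : m ∈ S'
        · obtain ⟨b, hmb, hb⟩ := ih hm ht
          exact ⟨b, (adj' _ hs _ hm hadj).reachable.trans hmb, hb⟩
        · obtain ⟨a, ha, hga, -⟩ := lost s hs m hadj hm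
          exact from_gate s hs a ha hga
    exact walk p hx hb

end SimpleGraph

section Definability

open Set SimpleGraph

variable {X Ω : Type*} [MeasurableSpace X] [MeasurableSpace Ω]

theorem Measurable.comp_rel {R : X → X → Prop} (hR : Measurable fun p : X × X => R p.1 p.2)
    {φ ψ : Ω → X} (hφ : Measurable φ) (hψ : Measurable ψ) : Measurable fun ω => R (φ ω) (ψ ω) :=
  hR.comp (hφ.prodMk hψ)

/-- Choose, measurably, the first of countably many values satisfying a measurable condition. -/
theorem exists_measurable_choice {g : ℕ → X → X} (hg : ∀ n, Measurable (g n)) {P : ℕ → X → Prop}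
    (hP : ∀ n, Measurable (P n)) :
    ∃ f : X → X, Measurable f ∧ ∀ x, (∃ n, P n x) → ∃ n, P n x ∧ f x = g n x := by
  classical
  have hex : ∀ x, ∃ n, P n x ∨ ∀ m, ¬ P m x := by
    intro x
    by_cases h : ∃ n, P n x
    · obtain ⟨n, hn⟩ := h
      exact ⟨n, Or.inl hn⟩
    · exact ⟨0, Or.inr fun m hm => h ⟨m, hm⟩⟩
  refine ⟨fun x => g (Nat.find (hex x)) x, Measurable.find hg (fun n => ?_) hex, ?_⟩
  · exact measurableSet_setOfPred.2 ((hP n).or (Measurable.forall fun m => (hP m).not))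
  · rintro x ⟨n, hn⟩
    refine ⟨Nat.find (hex x), ?_, rfl⟩
    rcases Nat.find_spec (hex x) with h | h
    · exact h
    · exact absurd hn (h n)

namespace EnumeratesComponents

variable {G Γ : SimpleGraph X} {h : ℕ → X → X}

theorem measurable_exists (hh : EnumeratesComponents G h) {φ : Ω → X} (hφ : Measurable φ)
    {Q : Ω → X → Prop} (hQ : Measurable fun p : Ω × X => Q p.1 p.2)
    (hr : ∀ ω z, Q ω z → G.Reachable (φ ω) z) : Measurable fun ω => ∃ z, Q ω z := by
  have : (fun ω => ∃ z, Q ω z) = fun ω => ∃ n, Q ω (h n (φ ω)) := by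
    funext ω
    refine propext ⟨?_, fun ⟨n, hn⟩ => ⟨_, hn⟩⟩
    rintro ⟨z, hz⟩
    obtain ⟨n, rfl⟩ := (hh.reachable_iff _ _).1 (hr ω z hz)
    exact ⟨n, hz⟩
  rw [this]
  exact Measurable.exists fun n =>
    hQ.comp (measurable_id.prodMk ((hh.measurable n).comp hφ))

theorem measurable_forall (hh : EnumeratesComponents G h) {φ : Ω → X} (hφ : Measurable φ)
    {Q : Ω → X → Prop} (hQ : Measurable fun p : Ω × X => Q p.1 p.2)
    (hr : ∀ ω z, ¬ Q ω z → G.Reachable (φ ω) z) : Measurable fun ω => ∀ z, Q ω z := by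
  have := (hh.measurable_exists hφ hQ.not hr).not
  simpa only [not_exists, not_not] using this

theorem measurable_reachable_dist_le (hh : EnumeratesComponents G h) (hle : Γ ≤ G)
    (hΓ : Measurable fun p : X × X => Γ.Adj p.1 p.2)
    (hdiag : Measurable fun p : X × X => p.1 = p.2) (n : ℕ) :
    Measurable fun p : X × X => Γ.Reachable p.1 p.2 ∧ Γ.dist p.1 p.2 ≤ n := by
  induction n with
  | zero =>
    convert! hdiag using 2 with p
    refine ⟨fun hp => hp.1.dist_eq_zero_iff.1 (Nat.le_zero.1 hp.2), fun hp => ?_⟩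
    rw [hp]
    exact ⟨Reachable.refl _, by simp⟩
  | succ n ih =>
    have step : (fun p : X × X => Γ.Reachable p.1 p.2 ∧ Γ.dist p.1 p.2 ≤ n + 1) =
        fun p => (Γ.Reachable p.1 p.2 ∧ Γ.dist p.1 p.2 ≤ n) ∨
          ∃ z, Γ.Adj p.1 z ∧ Γ.Reachable z p.2 ∧ Γ.dist z p.2 ≤ n := by
      funext ⟨x, y⟩
      refine propext ⟨?_, ?_⟩
      · rintro ⟨hr, hd⟩
        by_cases hne : y = x
        · subst hne
          exact Or.inl ⟨hr, by simp⟩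
        · obtain ⟨z, hz, hrz, hdz⟩ := hr.symm.exists_adj_dist hne
          simp only at hd
          rw [SimpleGraph.dist_comm, hdz, SimpleGraph.dist_comm] at hd
          exact Or.inr ⟨z, hz, hrz.symm, by omega⟩
      · rintro (⟨hr, hd⟩ | ⟨z, hz, hrz, hdz⟩)
        · exact ⟨hr, by omega⟩
        · refine ⟨hz.reachable.trans hrz, ?_⟩
          have t : Γ.dist x y ≤ Γ.dist x z + Γ.dist z y := hz.reachable.dist_triangle_left y
          have e : Γ.dist x z = 1 := dist_eq_one_iff_adj.mpr hz
          change Γ.dist z y ≤ n at hdz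
          change Γ.dist x y ≤ n + 1
          omega
    rw [step]
    refine ih.or (hh.measurable_exists measurable_fst ?_ fun p z hz =>
      (Adj.reachable hz.1).mono hle)
    exact (hΓ.comp_rel measurable_fst.fst measurable_snd).and
      (ih.comp (measurable_snd.prodMk measurable_fst.snd))

theorem measurable_reachable (hh : EnumeratesComponents G h) (hle : Γ ≤ G)
    (hΓ : Measurable fun p : X × X => Γ.Adj p.1 p.2)
    (hdiag : Measurable fun p : X × X => p.1 = p.2) :
    Measurable fun p : X × X => Γ.Reachable p.1 p.2 := by
  have : (fun p : X × X => Γ.Reachable p.1 p.2) =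
      fun p => ∃ n, Γ.Reachable p.1 p.2 ∧ Γ.dist p.1 p.2 ≤ n :=
    funext fun p => propext ⟨fun hp => ⟨_, hp, le_rfl⟩, fun ⟨_, hp, _⟩ => hp⟩
  rw [this]
  exact Measurable.exists fun n => hh.measurable_reachable_dist_le hle hΓ hdiag n

theorem measurable_dist (hh : EnumeratesComponents G h) (hle : Γ ≤ G)
    (hΓ : Measurable fun p : X × X => Γ.Adj p.1 p.2)
    (hdiag : Measurable fun p : X × X => p.1 = p.2) :
    Measurable fun p : X × X => Γ.dist p.1 p.2 := by
  refine measurable_of_Iic fun n => ?_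
  have : (fun p : X × X => Γ.dist p.1 p.2) ⁻¹' Iic n =
      {p | (Γ.Reachable p.1 p.2 ∧ Γ.dist p.1 p.2 ≤ n) ∨ ¬ Γ.Reachable p.1 p.2} := by
    ext p
    by_cases hp : Γ.Reachable p.1 p.2
    · simp [hp]
    · simp [hp, dist_eq_zero_of_not_reachable hp]
  rw [this]
  exact measurableSet_setOfPred.2 ((hh.measurable_reachable_dist_le hle hΓ hdiag n).or
    (hh.measurable_reachable hle hΓ hdiag).not)

theorem measurable_between (hh : EnumeratesComponents G h) (hle : Γ ≤ G)
    (hΓ : Measurable fun p : X × X => Γ.Adj p.1 p.2)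
    (hdiag : Measurable fun p : X × X => p.1 = p.2) {φ χ ψ : Ω → X} (hφ : Measurable φ)
    (hχ : Measurable χ) (hψ : Measurable ψ) :
    Measurable fun ω => Γ.Between (φ ω) (χ ω) (ψ ω) := by
  have hR := hh.measurable_reachable hle hΓ hdiag
  have hd := hh.measurable_dist hle hΓ hdiag
  refine (hR.comp_rel hφ hχ).and ((hR.comp_rel hχ hψ).and (measurableSet_setOfPred.1 ?_))
  exact measurableSet_eq_fun (hd.comp (hφ.prodMk hψ))
    ((hd.comp (hφ.prodMk hχ)).add (hd.comp (hχ.prodMk hψ)))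

theorem measurable_branch (hh : EnumeratesComponents G h) (hle : Γ ≤ G)
    (hΓ : Measurable fun p : X × X => Γ.Adj p.1 p.2)
    (hdiag : Measurable fun p : X × X => p.1 = p.2) : Measurable Γ.Branch := by
  refine hh.measurable_exists measurable_id
    (hh.measurable_exists measurable_fst (hh.measurable_exists measurable_fst.fst ?_ ?_) ?_) ?_
  · exact (hΓ.comp_rel measurable_fst.fst.fst measurable_fst.fst.snd).and
      ((hΓ.comp_rel measurable_fst.fst.fst measurable_fst.snd).and
        ((hΓ.comp_rel measurable_fst.fst.fst measurable_snd).and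
          ((hdiag.comp_rel measurable_fst.fst.snd measurable_fst.snd).not.and
            ((hdiag.comp_rel measurable_fst.fst.snd measurable_snd).not.and
              (hdiag.comp_rel measurable_fst.snd measurable_snd).not))))
  · exact fun _ _ hz => (Adj.reachable hz.2.2.1).mono hle
  · exact fun _ _ ⟨_, hz⟩ => (Adj.reachable hz.2.1).mono hle
  · exact fun _ _ ⟨_, _, hz⟩ => (Adj.reachable hz.1).mono hle

theorem measurable_big (hh : EnumeratesComponents G h) (hle : Γ ≤ G)
    (hΓ : Measurable fun p : X × X => Γ.Adj p.1 p.2)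
    (hdiag : Measurable fun p : X × X => p.1 = p.2) :
    Measurable fun p : X × X => Γ.Big p.1 p.2 := by
  have hB := hh.measurable_branch hle hΓ hdiag
  refine hdiag.not.and ((hB.comp measurable_snd).and
    (hh.measurable_exists measurable_fst ?_ fun _ _ hz => hz.2.1.reachable.mono hle))
  exact (hdiag.comp_rel measurable_snd measurable_fst.snd).not.and
    ((hh.measurable_between hle hΓ hdiag measurable_fst.fst measurable_fst.snd measurable_snd).and
      (hB.comp measurable_snd))

theorem measurable_mem_hull (hh : EnumeratesComponents G h) (hle : Γ ≤ G)
    (hΓ : Measurable fun p : X × X => Γ.Adj p.1 p.2)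
    (hdiag : Measurable fun p : X × X => p.1 = p.2) :
    Measurable fun p : X × X => p.2 ∈ Γ.hull p.1 := by
  refine (hh.measurable_reachable hle hΓ hdiag).and
    (hh.measurable_forall measurable_fst ?_ fun _ _ hz => ?_)
  · exact (hh.measurable_between hle hΓ hdiag measurable_fst.fst measurable_snd
      measurable_fst.snd).imp
        ((hh.measurable_big hle hΓ hdiag).comp_rel measurable_fst.fst measurable_snd).not
  · rw [Classical.not_imp] at hz
    exact hz.1.1.mono hle

theorem measurable_mem_gate (hh : EnumeratesComponents G h) (hle : Γ ≤ G)
    (hΓ : Measurable fun p : X × X => Γ.Adj p.1 p.2)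
    (hdiag : Measurable fun p : X × X => p.1 = p.2) :
    Measurable fun p : X × X => p.2 ∈ Γ.gate p.1 :=
  (hh.measurable_big hle hΓ hdiag).and (hh.measurable_exists measurable_snd
    ((hΓ.comp_rel measurable_fst.snd measurable_snd).and
      ((hh.measurable_mem_hull hle hΓ hdiag).comp (measurable_fst.fst.prodMk measurable_snd)))
    fun _ _ hz => (Adj.reachable hz.1).mono hle)

theorem measurable_hullRadius (hh : EnumeratesComponents G h) (hle : Γ ≤ G)
    (hΓ : Measurable fun p : X × X => Γ.Adj p.1 p.2)
    (hdiag : Measurable fun p : X × X => p.1 = p.2) (r : ℕ) : Measurable (Γ.HullRadius r) := by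
  have hB := hh.measurable_branch hle hΓ hdiag
  have hle_r : Measurable fun p : X × X => Γ.dist p.1 p.2 ≤ r :=
    measurableSet_setOfPred.1
      (measurableSet_le (hh.measurable_dist hle hΓ hdiag) measurable_const)
  refine (hh.measurable_forall measurable_id ?_ fun _ _ hz => ?_).and
    (hh.measurable_forall measurable_id (Measurable.imp ?_ ?_) fun _ _ hz => ?_)
  · exact (hh.measurable_mem_hull hle hΓ hdiag).imp ((hB.comp measurable_snd).imp hle_r)
  · rw [Classical.not_imp] at hz
    exact hz.1.1.mono hle
  · exact hh.measurable_mem_gate hle hΓ hdiag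
  · refine hh.measurable_exists measurable_fst ?_ fun _ _ hz => hz.2.1.reachable.mono hle
    exact (hdiag.comp_rel measurable_snd measurable_fst.snd).not.and
      ((hh.measurable_between hle hΓ hdiag measurable_fst.fst measurable_fst.snd
        measurable_snd).and ((hB.comp measurable_snd).and
          (hle_r.comp (measurable_fst.fst.prodMk measurable_snd))))
  · rw [Classical.not_imp] at hz
    exact hz.1.1.reachable.mono hle

end EnumeratesComponents

end Definability

section Peeling

open Set SimpleGraph

theorem SimpleGraph.finite_reachable_dist_le {V : Type*} {G : SimpleGraph V}
    (hlf : ∀ x, (G.neighborSet x).Finite) (x : V) (n : ℕ) :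
    {y | G.Reachable x y ∧ G.dist x y ≤ n}.Finite := by
  induction n with
  | zero =>
    refine (finite_singleton x).subset fun y hy => ?_
    exact (hy.1.dist_eq_zero_iff.1 (Nat.le_zero.1 hy.2)).symm
  | succ n ih =>
    refine (ih.union (ih.biUnion fun z _ => hlf z)).subset fun y hy => ?_
    by_cases hne : x = y
    · subst hne
      exact Or.inl ⟨Reachable.refl _, by simp⟩
    · obtain ⟨z, hz, hrz, hdz⟩ := hy.1.exists_adj_dist hne
      have := hy.2
      exact Or.inr (mem_biUnion (x := z) ⟨hrz, by omega⟩ hz.symm)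

variable {X : Type*} [MeasurableSpace X]

/-- The measurable function `f` is one-ended on `S \ T` and sends it into `S` along `G`. -/
structure Peel (G : SimpleGraph X) (S T : Set X) (f : X → X) : Prop where
  subset : T ⊆ S
  measurableSet : MeasurableSet T
  measurable : Measurable f
  adj : ∀ v ∈ S \ T, G.Adj v (f v) ∧ f v ∈ S
  not_exists_chain : ¬ ∃ u : ℕ → X, ∀ i, u i ∈ S \ T ∧ f (u (i + 1)) = u i

theorem EnumeratesComponents.exists_peels {G : SimpleGraph X} {h : ℕ → X → X}
    (hh : EnumeratesComponents G h) (hG : G.IsAcyclic) (hlf : ∀ x, (G.neighborSet x).Finite)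
    (hadj : Measurable fun p : X × X => G.Adj p.1 p.2)
    (hdiag : Measurable fun p : X × X => p.1 = p.2)
    {V : ℕ → Set X} (hVm : ∀ n, MeasurableSet (V n))
    (hV : ∀ (a : X) (F : Set X), F.Finite → a ∉ F → ∃ n, a ∈ V n ∧ ∀ b ∈ F, b ∉ V n)
    {S : Set X} (hSm : MeasurableSet S) (hS : G.Bushy S) :
    ∃ T : ℕ × ℕ → Set X, (∀ i, G.Bushy (T i) ∧ ∃ f, Peel G S (T i) f) ∧
      ∀ x ∈ S, ∃ i, x ∉ T i := by
  set Γ := G.restr S with hΓdef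
  have hle : Γ ≤ G := restr_le G S
  have hΓG : Γ.IsAcyclic := hG.anti hle
  have hΓlf : ∀ x, (Γ.neighborSet x).Finite := fun x => (hlf x).subset fun y hy => hle hy
  have hSmem : Measurable fun x => x ∈ S := measurableSet_setOfPred.1 hSm
  have hΓ : Measurable fun p : X × X => Γ.Adj p.1 p.2 :=
    hadj.and ((hSmem.comp measurable_fst).and (hSmem.comp measurable_snd))
  have hd := hh.measurable_dist hle hΓ hdiag
  have hR := hh.measurable_reachable hle hΓ hdiag
  have hH := hh.measurable_mem_hull hle hΓ hdiag
  let A : ℕ × ℕ → Set X := fun i => {a | Γ.Branch a ∧ Γ.HullRadius i.1 a ∧ a ∈ V i.2 ∧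
    ∀ b, b ≠ a → Γ.Reachable a b → Γ.dist a b ≤ 2 * i.1 + 1 → b ∉ V i.2}
  have hAm : ∀ i, Measurable fun a => a ∈ A i := by
    intro i
    have hVi : Measurable fun x => x ∈ V i.2 := measurableSet_setOfPred.1 (hVm i.2)
    refine (hh.measurable_branch hle hΓ hdiag).and
      ((hh.measurable_hullRadius hle hΓ hdiag i.1).and (hVi.and
        (hh.measurable_forall measurable_id ?_ fun _ _ hz => ?_)))
    · exact (hdiag.comp_rel measurable_snd measurable_fst).not.imp
        (hR.imp (Measurable.imp (measurableSet_setOfPred.1 (measurableSet_le hd measurable_const))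
          (hVi.comp measurable_snd).not))
    · push Not at hz
      exact hz.2.1.mono hle
  have hA : ∀ i, Γ.Spread i.1 (A i) := by
    intro i
    refine ⟨fun a ha => ha.1, fun a ha => ha.2.1, fun a ha b hb hne hr => ?_⟩
    by_contra hcon
    exact ha.2.2.2 b hne.symm hr (by omega) hb.2.2.1
  have hAS : ∀ i, ∀ a ∈ A i, a ∈ S := by
    rintro i a ⟨⟨y, -, -, hy, -⟩, -⟩
    exact hy.2.1
  have hullS : ∀ i, ∀ a ∈ A i, ∀ v ∈ Γ.hull a, v ∈ S := by
    intro i a ha v hv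
    by_cases hne : a = v
    · exact hne ▸ hAS i a ha
    · obtain ⟨u, hu, -⟩ := hv.1.exists_adj_dist hne
      exact hu.2.1
  refine ⟨fun i => S \ {v | ∃ a ∈ A i, v ∈ Γ.hull a},
    fun i => ⟨(hA i).bushy hG hS, ?_⟩, fun x hx => ?_⟩
  · have hQ : Measurable fun p : (X × X) × X =>
        p.2 ∈ A i ∧ p.1.1 ∈ Γ.hull p.2 ∧ Γ.dist p.2 p.1.2 = Γ.dist p.2 p.1.1 + 1 :=
      ((hAm i).comp measurable_snd).and
        ((hH.comp (measurable_snd.prodMk measurable_fst.fst)).and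
          (measurableSet_setOfPred.1 (measurableSet_eq_fun
            (hd.comp (measurable_snd.prodMk measurable_fst.snd))
            ((hd.comp (measurable_snd.prodMk measurable_fst.fst)).add measurable_const))))
    have hP : Measurable fun p : X × X => Γ.Adj p.1 p.2 ∧
        ∃ a, a ∈ A i ∧ p.1 ∈ Γ.hull a ∧ Γ.dist a p.2 = Γ.dist a p.1 + 1 :=
      hΓ.and (hh.measurable_exists measurable_fst hQ fun _ _ hz => hz.2.1.1.symm.mono hle)
    obtain ⟨f, hfm, hf⟩ := exists_measurable_choice hh.measurable
      fun n => hP.comp (measurable_id.prodMk (hh.measurable n))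
    have hf' : ∀ a ∈ A i, ∀ v ∈ Γ.hull a, Γ.Adj v (f v) ∧ Γ.dist a (f v) = Γ.dist a v + 1 := by
      intro a ha v hv
      have hex : ∃ y, Γ.Adj v y ∧ Γ.dist a y = Γ.dist a v + 1 := by
        obtain ⟨y₁, y₂, h₁, h₂, hne⟩ := (hS v (hullS i a ha v hv)).1
        rcases hΓG.dist_cases h₁ hv.1 with e₁ | e₁
        · rcases hΓG.dist_cases h₂ hv.1 with e₂ | e₂
          · exact absurd (hΓG.eq_of_adj_closer hv.1 h₁ h₂ e₁ e₂) hne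
          · exact ⟨y₂, h₂, e₂⟩
        · exact ⟨y₁, h₁, e₁⟩
      obtain ⟨y, hy, hdy⟩ := hex
      obtain ⟨n, rfl⟩ := (hh.reachable_iff v y).1 (hy.reachable.mono hle)
      obtain ⟨m, ⟨hm, b, hb, hvb, hdb⟩, hfv⟩ := hf v ⟨n, hy, a, ha, hv, hdy⟩
      obtain rfl := (hA i).eq_of_mem_hull hΓG ha hb hv hvb
      rw [hfv]
      exact ⟨hm, hdb⟩
    have hmem : ∀ v ∈ S \ (S \ {v | ∃ a ∈ A i, v ∈ Γ.hull a}), ∃ a ∈ A i, v ∈ Γ.hull a := by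
      intro v hv
      by_contra hcon
      exact hv.2 ⟨hv.1, hcon⟩
    refine ⟨f, sdiff_subset, hSm.diff (measurableSet_setOfPred.2 ?_), hfm, fun v hv => ?_, ?_⟩
    · exact hh.measurable_exists measurable_id
        (((hAm i).comp measurable_snd).and (hH.comp (measurable_snd.prodMk measurable_fst)))
        fun _ _ hz => hz.2.1.symm.mono hle
    · obtain ⟨a, ha, hva⟩ := hmem v hv
      have := (hf' a ha v hva).1
      exact ⟨this.1, this.2.2⟩
    · rintro ⟨u, hu⟩
      exact (hA i).not_exists_chain hΓG hf' ⟨u, fun i => ⟨hmem _ (hu i).1, (hu i).2⟩⟩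
  · obtain ⟨b, hxb, hb⟩ := (hS x hx).2
    obtain ⟨a, ha, hxa⟩ := exists_mem_hull hb hxb
    obtain ⟨r, hr⟩ := hΓG.exists_hullRadius (hΓlf a)
    obtain ⟨n, hn, hn'⟩ := hV a ({b | Γ.Reachable a b ∧ Γ.dist a b ≤ 2 * r + 1} \ {a})
      (finite_reachable_dist_le hΓlf a _).sdiff (by simp)
    exact ⟨(r, n), fun hcon => hcon.2 ⟨a, ⟨ha, hr, hn,
      fun b hne hrb hdb => hn' b ⟨⟨hrb, hdb⟩, hne⟩⟩, hxa⟩⟩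

end Peeling

section Gluing

open Set SimpleGraph TopologicalSpace Filter

variable {X : Type*} [MeasurableSpace X]

theorem Peel.mono_diff {G : SimpleGraph X} {T : ℕ → Set X} {f : ℕ → X → X}
    (hT : ∀ n, Peel G (T n) (T (n + 1)) (f n)) : Antitone T :=
  antitone_nat_of_succ_le fun n => (hT n).subset

/-- Countably many one-ended functions on successive layers glue to a one-ended function. -/
theorem Peel.exists_oneEnded {G : SimpleGraph X} {T : ℕ → Set X} {f : ℕ → X → X}
    (hT0 : MeasurableSet (T 0)) (hT : ∀ n, Peel G (T n) (T (n + 1)) (f n)) :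
    ∃ g : (⋃ n, T n \ T (n + 1) : Set X) → X,
      Measurable g ∧ (∀ x : (⋃ n, T n \ T (n + 1) : Set X), G.Adj (x : X) (g x)) ∧ OneEnded g := by
  have hanti := Peel.mono_diff hT
  have hm : ∀ n, MeasurableSet (T n) := fun n => by
    cases n with
    | zero => exact hT0
    | succ n => exact (hT n).measurableSet
  have huniq : ∀ {m n x}, x ∈ T m \ T (m + 1) → x ∈ T n → n ≤ m := by
    intro m n x hx hxn
    by_contra hcon
    exact hx.2 (hanti (by omega) hxn)
  obtain ⟨g, hgm, hg⟩ := exists_measurable_choice (fun n => (hT n).measurable)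
    (P := fun n x => x ∈ T n \ T (n + 1))
    fun n => measurableSet_setOfPred.1 ((hm n).diff (hm (n + 1)))
  have hgf : ∀ n, ∀ x ∈ T n \ T (n + 1), g x = f n x := by
    intro n x hx
    obtain ⟨m, hm, hgx⟩ := hg x ⟨n, hx⟩
    rw [hgx, le_antisymm (huniq hx hm.1) (huniq hm hx.1)]
  refine ⟨fun x => g x, hgm.comp measurable_subtype_coe, fun x => ?_, ?_⟩
  · obtain ⟨n, hn⟩ := mem_iUnion.1 x.2
    change G.Adj x (g x)
    rw [hgf n x hn]
    exact ((hT n).adj x hn).1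
  · rintro ⟨u, hu⟩
    choose l hl using fun i => mem_iUnion.1 (u i).2
    have hstep : ∀ i, l (i + 1) ≤ l i := by
      intro i
      refine huniq (hl i) ?_
      have he : g (u (i + 1)) = u i := hu i
      rw [← he, hgf _ _ (hl (i + 1))]
      exact ((hT _).adj _ (hl (i + 1))).2
    have hlanti : Antitone l := antitone_nat_of_succ_le hstep
    obtain ⟨N, hN⟩ : ∃ N, ∀ i, l N ≤ l i := by
      obtain ⟨_, ⟨N, rfl⟩, hN⟩ := WellFounded.has_min (wellFounded_lt (α := ℕ)) (range l)
        (range_nonempty l)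
      exact ⟨N, fun i => not_lt.1 (hN _ ⟨i, rfl⟩)⟩
    have hconst : ∀ i, l (N + i) = l N := fun i =>
      le_antisymm (hlanti (Nat.le_add_right N i)) (hN _)
    have hl' : ∀ i, (u (N + i) : X) ∈ T (l N) \ T (l N + 1) := fun i => hconst i ▸ hl (N + i)
    refine (hT (l N)).not_exists_chain ⟨fun i => u (N + i), fun i => ⟨hl' i, ?_⟩⟩
    rw [← hgf _ _ (hl' (i + 1))]
    exact hu (N + i)

theorem exists_comeagre_oneEnded_of_bushy [TopologicalSpace X] [PolishSpace X] [BorelSpace X]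
    {G : SimpleGraph X} (hG : G.IsAcyclic) (hlf : ∀ x, (G.neighborSet x).Finite)
    (hadj : Measurable fun p : X × X => G.Adj p.1 p.2)
    {R : Set X} {f₀ : X → X} (hR : G.Bushy R) (hR₀ : Peel G univ R f₀) :
    ∃ B : Set X, MeasurableSet B ∧ B ∈ residual X ∧
      ∃ f : B → X, Measurable f ∧ (∀ x : B, G.Adj (x : X) (f x)) ∧ OneEnded f := by
  have hdiag : Measurable fun p : X × X => p.1 = p.2 :=
    measurableSet_setOfPred.1 (measurableSet_eq_fun measurable_fst measurable_snd)
  obtain ⟨h, hh⟩ := exists_enumeratesComponents (measurableSet_setOfPred.2 hadj) hlf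
  obtain ⟨V, hVm, hV⟩ := exists_measurableSet_separating X
  obtain ⟨U, hU⟩ := ((countable_countableBasis X).insert ∅).exists_eq_range (insert_nonempty _ _)
  have hUo : ∀ n, IsOpen (U n) := by
    intro n
    have : U n ∈ insert ∅ (countableBasis X) := hU ▸ mem_range_self n
    rcases this with h | h
    · rw [h]; exact isOpen_empty
    · exact isOpen_of_mem_countableBasis h
  let State := {S : Set X // MeasurableSet S ∧ G.Bushy S}
  have step : ∀ (n : ℕ) (S : State), ∃ (T : State) (f : X → X),
      Peel G S.1 T.1 f ∧ ((U n).Nonempty → ¬ IsMeagre (U n \ T.1)) := by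
    rintro n ⟨S, hSm, hS⟩
    obtain ⟨T, hT, hTS⟩ := hh.exists_peels hG hlf hadj hdiag hVm hV hSm hS
    have hpick : ∃ i, (U n).Nonempty → ¬ IsMeagre (U n \ T i) := by
      by_contra hcon
      push Not at hcon
      refine not_isMeagre_of_isOpen (hUo n) (hcon (0, 0)).1
        ((isMeagre_iUnion fun i => (hcon i).2).mono fun x hx => ?_)
      rw [mem_iUnion]
      by_cases hxS : x ∈ S
      · obtain ⟨i, hi⟩ := hTS x hxS
        exact ⟨i, hx, hi⟩
      · obtain ⟨-, f, hf⟩ := hT (0, 0)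
        exact ⟨(0, 0), hx, fun hcon => hxS (hf.subset hcon)⟩
    obtain ⟨i, hi⟩ := hpick
    obtain ⟨hTi, f, hf⟩ := hT i
    exact ⟨⟨T i, hf.measurableSet, hTi⟩, f, hf, hi⟩
  choose F f hF hFU using step
  let s : ℕ → State := fun n => Nat.rec ⟨R, hR₀.measurableSet, hR⟩ F n
  let T : ℕ → Set X := fun n => Nat.casesOn (motive := fun _ => Set X) n univ fun m => (s m).1
  let φ : ℕ → X → X := fun n => Nat.casesOn n f₀ fun m => f m (s m)
  have hT : ∀ n, Peel G (T n) (T (n + 1)) (φ n) := by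
    intro n
    cases n with
    | zero => exact hR₀
    | succ n => exact hF n (s n)
  have hTU : ∀ n, (U n).Nonempty → ¬ IsMeagre (U n \ T (n + 2)) := fun n => hFU n (s n)
  have hB : MeasurableSet (⋃ n, T n \ T (n + 1)) := by
    refine MeasurableSet.iUnion fun n => MeasurableSet.diff ?_ (hT n).measurableSet
    cases n with
    | zero => exact MeasurableSet.univ
    | succ n => exact (hT n).measurableSet
  refine ⟨_, hB, ?_, Peel.exists_oneEnded MeasurableSet.univ hT⟩
  have hmem : ∀ (n : ℕ) (x : X), x ∉ T n → x ∈ ⋃ n, T n \ T (n + 1) := by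
    intro n
    induction n with
    | zero => exact fun x hx => absurd (mem_univ x) hx
    | succ n ih =>
      intro x hx
      by_cases hxn : x ∈ T n
      · exact mem_iUnion.2 ⟨n, hxn, hx⟩
      · exact ih x hxn
  obtain ⟨W, hWo, hW⟩ := hB.compl.residualEq_isOpen
  rcases W.eq_empty_or_nonempty with rfl | ⟨w, hw⟩
  · filter_upwards [hW] with x hx
    by_contra hcon
    exact (eq_iff_iff.1 hx).1 hcon
  · exfalso
    obtain ⟨Z, hZ, hwZ, hZW⟩ := (isBasis_countableBasis X).exists_subset_of_mem_open hw hWo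
    obtain ⟨n, rfl⟩ : Z ∈ range U := hU ▸ mem_insert_of_mem _ hZ
    refine hTU n ⟨w, hwZ⟩ ?_
    change _ ∈ residual X
    filter_upwards [hW] with x hx hxU
    exact (eq_iff_iff.1 hx).2 (hZW hxU.1) (hmem (n + 2) x hxU.2)

end Gluing

namespace SimpleGraph

universe u

variable {V : Type u} {G : SimpleGraph V}

/-- An infinite walk from `x` that never turns back. -/
structure IsRay (G : SimpleGraph V) (x : V) (q : ℕ → V) : Prop where
  zero : q 0 = x
  adj : ∀ n, G.Adj (q n) (q (n + 1))
  ne : ∀ n, q (n + 2) ≠ q n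

theorem IsRay.reachable {x : V} {q : ℕ → V} (hq : G.IsRay x q) (n : ℕ) :
    G.Reachable x (q n) := by
  induction n with
  | zero => rw [hq.zero]
  | succ n ih => exact ih.trans (hq.adj n).reachable

theorem IsRay.dist_eq {x : V} {q : ℕ → V} (hG : G.IsAcyclic) (hq : G.IsRay x q) (n : ℕ) :
    G.dist x (q n) = n := by
  induction n using Nat.twoStepInduction with
  | zero => rw [hq.zero, dist_self]
  | one => rw [← hq.zero]; exact dist_eq_one_iff_adj.2 (hq.adj 0)
  | more n h₀ h₁ =>
    rcases hG.dist_cases (hq.adj (n + 1)) (hq.reachable _) with h | h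
    · exact absurd (hG.eq_of_adj_closer (hq.reachable _) (hq.adj (n + 1)) (hq.adj n).symm h
        (by rw [h₀, h₁])) (hq.ne n)
    · change G.dist x (q (n + 1 + 1)) = _
      omega

theorem IsRay.between {x : V} {q : ℕ → V} (hG : G.IsAcyclic) (hq : G.IsRay x q) {n m : ℕ}
    (hnm : n ≤ m) : G.Between x (q n) (q m) := by
  induction m, hnm using Nat.le_induction with
  | base => exact between_self_right (hq.reachable n)
  | succ m _ ih => exact ih.child (hq.adj m) (by rw [hq.dist_eq hG, hq.dist_eq hG])

theorem IsAcyclic.eq_of_between (hG : G.IsAcyclic) {x a b w : V} (ha : G.Between x a w)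
    (hb : G.Between x b w) (hd : G.dist x a = G.dist x b) : a = b := by
  induction hn : G.dist x w using Nat.strong_induction_on generalizing w with
  | _ n ih =>
    have key : ∀ {c d : V}, G.Between x c w → G.Between x d w → G.dist x c = G.dist x d →
        c = w → d = w := by
      rintro c d - hd hcd rfl
      exact hd.2.1.dist_eq_zero_iff.1 (by have := hd.2.2; omega)
    by_cases haw : a = w
    · exact haw.trans (key ha hb hd haw).symm
    by_cases hbw : b = w
    · exact absurd (key hb ha hd.symm hbw) haw
    have hxw : x ≠ w := by
      rintro rfl
      exact haw (ha.2.1.dist_eq_zero_iff.1 (by have := ha.2.2; rw [dist_self] at this; omega))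
    obtain ⟨u, hadj, -, hu⟩ := ha.reachable.exists_adj_dist hxw
    exact ih _ (by omega) (hG.between_parent ha haw hadj hu) (hG.between_parent hb hbw hadj hu) rfl

theorem Reachable.exists_between {x w : V} (h : G.Reachable x w) {k : ℕ} (hk : k ≤ G.dist x w) :
    ∃ u, G.Between x u w ∧ G.dist x u = k := by
  induction k with
  | zero => exact ⟨x, between_self_left h, dist_self⟩
  | succ k ih =>
    obtain ⟨u, hu, hd⟩ := ih (by omega)
    obtain ⟨v, -, hv, hb⟩ := hu.exists_child (by rintro rfl; omega)
    exact ⟨v, hb, by omega⟩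

/-- A sequence of vertices eventually lies in each of the components chosen by `e`. -/
def TendsToEnd (G : SimpleGraph V) (q : ℕ → V) (e : ∀ K : (Finset V)ᵒᵖ, G.ComponentCompl K.unop) :
    Prop :=
  ∀ K, ∃ N, ∀ n ≥ N, q n ∈ e K

theorem TendsToEnd.unique {q : ℕ → V} {e e' : ∀ K : (Finset V)ᵒᵖ, G.ComponentCompl K.unop}
    (h : G.TendsToEnd q e) (h' : G.TendsToEnd q e') : e = e' := by
  funext K
  obtain ⟨N, hN⟩ := h K
  obtain ⟨N', hN'⟩ := h' K
  obtain ⟨_, h₁⟩ := hN (max N N') (le_max_left _ _)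
  obtain ⟨_, h₂⟩ := hN' (max N N') (le_max_right _ _)
  exact h₁.symm.trans h₂

theorem IsRay.exists_tendsToEnd (hG : G.IsAcyclic) {x : V} {q : ℕ → V} (hq : G.IsRay x q) :
    ∃ e ∈ G.end, G.TendsToEnd q e := by
  have hesc : ∀ K : (Finset V)ᵒᵖ, ∃ N, ∀ n ≥ N, q n ∉ K.unop := by
    intro K
    refine ⟨K.unop.sup (G.dist x) + 1, fun n hn hK => ?_⟩
    have := Finset.le_sup (f := G.dist x) hK
    rw [hq.dist_eq hG] at this
    omega
  choose N hN using hesc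
  let e : ∀ K : (Finset V)ᵒᵖ, G.ComponentCompl K.unop :=
    fun K => G.componentComplMk (hN K (N K) le_rfl)
  have he : ∀ K, ∀ n ≥ N K, q n ∈ e K := by
    intro K n hn
    induction n, hn using Nat.le_induction with
    | base => exact G.componentComplMk_mem _
    | succ n hn ih => exact ComponentCompl.mem_of_adj _ _ ih (hN K _ (by omega)) (hq.adj n)
  refine ⟨e, ?_, fun K => ⟨N K, he K⟩⟩
  intro K L f
  refine (ComponentCompl.hom_eq_iff_not_disjoint (e K) (CategoryTheory.le_of_op_hom f) (e L)).2 ?_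
  rw [Set.not_disjoint_iff]
  exact ⟨q (max (N K) (N L)), he K _ (le_max_left _ _), he L _ (le_max_right _ _)⟩

/-- The part of a component outside a ball has a root at the boundary of the ball. -/
theorem IsAcyclic.exists_root (hG : G.IsAcyclic) (hc : G.Preconnected) (x : V) {n : ℕ}
    {K : Set V} (hK : ∀ v, v ∈ K ↔ G.dist x v ≤ n) (C : G.ComponentCompl K) :
    ∃ u ∈ C, G.dist x u = n + 1 ∧ ∀ w ∈ C, G.Between x u w := by
  have hout : ∀ {v}, v ∉ K → n + 1 ≤ G.dist x v := fun {v} hv => by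
    rw [hK] at hv
    omega
  obtain ⟨w, hwK, hw⟩ := C.exists_eq_mk
  obtain ⟨u, hu, hd⟩ := (hc x w).exists_between (hout hwK)
  have huK : u ∉ K := by rw [hK]; omega
  have hdown : ∀ k v, G.Between x u v → G.dist u v = k → v ∈ C → u ∈ C := by
    intro k
    induction k with
    | zero =>
      intro v hv hk hvC
      rwa [hv.2.1.dist_eq_zero_iff.1 hk]
    | succ k ih =>
      intro v hv hk hvC
      have huv : u ≠ v := by
        rintro rfl
        rw [dist_self] at hk
        omega
      have hxv : x ≠ v := by
        rintro rfl
        exact absurd (hout (ComponentCompl.notMem_of_mem hvC)) (by simp)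
      obtain ⟨p, hadj, -, hp⟩ := hv.reachable.exists_adj_dist hxv
      have hup := hG.between_parent hv huv hadj hp
      have := hup.2.2
      have := hv.2.2
      exact ih p hup (by omega) (ComponentCompl.mem_of_adj v p hvC (by rw [hK]; omega) hadj)
  refine ⟨u, hdown _ w hu rfl ⟨hwK, hw⟩, hd, ?_⟩
  rintro v ⟨hvK, hv⟩
  obtain ⟨p⟩ := ConnectedComponent.exact (hw.trans hv.symm)
  have hup : ∀ {a b : ↥Kᶜ}, (G.induce Kᶜ).Walk a b → G.Between x u a → G.Between x u b := by
    intro a b p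
    induction p with
    | nil => exact id
    | @cons a m b hadj _ ih =>
      refine fun ha => ih ?_
      by_contra hm
      have hadj' : G.Adj a m := hadj
      have hua := hG.eq_of_between_of_not_between ha hm hadj'
      rcases hG.dist_cases hadj' (hc x a) with h | h
      · have := hout m.2
        rw [← hua] at h
        omega
      · exact hm (ha.child hadj' h)
  exact hup p hu

theorem Preconnected.exists_ball (hc : G.Preconnected)
    (hlf : ∀ x, (G.neighborSet x).Finite) (x : V) (n : ℕ) :
    ∃ K : Finset V, ∀ v, v ∈ K ↔ G.dist x v ≤ n :=
  ⟨(finite_reachable_dist_le hlf x n).toFinset, fun v => by simp [hc x v]⟩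

theorem IsRay.eq_of_tendsToEnd (hG : G.IsAcyclic) (hc : G.Preconnected)
    (hlf : ∀ x, (G.neighborSet x).Finite) {x : V} {q q' : ℕ → V}
    {e : ∀ K : (Finset V)ᵒᵖ, G.ComponentCompl K.unop} (hq : G.IsRay x q) (hq' : G.IsRay x q')
    (he : G.TendsToEnd q e) (he' : G.TendsToEnd q' e) : q = q' := by
  funext n
  cases n with
  | zero => rw [hq.zero, hq'.zero]
  | succ n =>
    obtain ⟨K, hK⟩ := hc.exists_ball hlf x n
    obtain ⟨u, -, hd, hu⟩ := hG.exists_root hc x hK (e (.op K))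
    have key : ∀ {r : ℕ → V}, G.IsRay x r → G.TendsToEnd r e → r (n + 1) = u := by
      intro r hr hre
      obtain ⟨N, hN⟩ := hre (.op K)
      exact hG.eq_of_between (hr.between hG (le_max_right N (n + 1)))
        (hu _ (hN _ (le_max_left _ _))) (by rw [hr.dist_eq hG, hd])
    rw [key hq he, key hq' he']

theorem IsAcyclic.exists_isRay_tendsToEnd (hG : G.IsAcyclic) (hc : G.Preconnected)
    (hlf : ∀ x, (G.neighborSet x).Finite) (x : V)
    {e : ∀ K : (Finset V)ᵒᵖ, G.ComponentCompl K.unop} (he : e ∈ G.end) :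
    ∃ q, G.IsRay x q ∧ G.TendsToEnd q e := by
  choose B hB using hc.exists_ball hlf x
  choose u hu hd hb using fun n => hG.exists_root hc x (hB n) (e (.op (B n)))
  have hsub : ∀ {K L : Finset V}, K ⊆ L → ∀ v ∈ e (.op L), v ∈ e (.op K) := by
    intro K L hKL v hv
    have := he (CategoryTheory.opHomOfLE hKL : Opposite.op L ⟶ Opposite.op K)
    rw [← this]
    exact ComponentCompl.subset_hom _ hKL hv
  have hmono : ∀ {n m}, n ≤ m → B n ⊆ B m := fun hnm v hv => by
    rw [hB] at hv ⊢
    omega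
  have hadj : ∀ n, G.Adj (u n) (u (n + 1)) := by
    intro n
    have := (hb n _ (hsub (hmono n.le_succ) _ (hu (n + 1)))).2.2
    rw [hd, hd] at this
    exact dist_eq_one_iff_adj.1 (by omega)
  refine ⟨fun n => n.casesOn x u, ⟨rfl, ?_, ?_⟩, ?_⟩
  · rintro (_ | n)
    · exact dist_eq_one_iff_adj.1 (hd 0)
    · exact hadj n
  · rintro (_ | n) h
    · have : u 1 = x := h
      have h' := hd 1
      rw [this, dist_self] at h'
      omega
    · have : u (n + 2) = u n := h
      have h' := hd (n + 2)
      rw [this, hd n] at h'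
      omega
  · intro K
    refine ⟨K.unop.sup (G.dist x) + 1, ?_⟩
    rintro (_ | n) hn
    · omega
    · refine hsub (L := B n) (fun v hv => ?_) _ (hu n)
      rw [hB]
      exact (Finset.le_sup (f := G.dist x) hv).trans (by omega)

theorem IsAcyclic.ncard_end (hG : G.IsAcyclic) (hc : G.Preconnected)
    (hlf : ∀ x, (G.neighborSet x).Finite) (x : V) :
    G.end.ncard = {q | G.IsRay x q}.ncard := by
  choose q hq hqe using fun e he => IsAcyclic.exists_isRay_tendsToEnd hG hc hlf x (e := e) he
  refine Set.ncard_congr q hq ?_ ?_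
  · intro e e' he he' h
    refine (hqe e he).unique ?_
    rw [h]
    exact hqe e' he'
  · intro r hr
    obtain ⟨e, he, hre⟩ := IsRay.exists_tendsToEnd hG hr
    exact ⟨e, he, IsRay.eq_of_tendsToEnd hG hc hlf (hq e he) hr (hqe e he) hre⟩

theorem IsAcyclic.ncard_end_induce_supp (hG : G.IsAcyclic)
    (hlf : ∀ x, (G.neighborSet x).Finite) (x : V) :
    (G.induce (G.connectedComponentMk x).supp).end.ncard = {q | G.IsRay x q}.ncard ∧
      ((G.induce (G.connectedComponentMk x).supp).end ≠ ∅ → ∃ q, G.IsRay x q) := by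
  set c := G.connectedComponentMk x
  have hG' : (G.induce c.supp).IsAcyclic :=
    hG.comap (Embedding.induce c.supp).toHom Subtype.val_injective
  have hc' : (G.induce c.supp).Preconnected := c.connected_toSimpleGraph.preconnected
  have hlf' : ∀ y, ((G.induce c.supp).neighborSet y).Finite := fun y =>
    Set.Finite.of_injOn (f := Subtype.val) (t := G.neighborSet y) (fun _ h => h)
      Subtype.val_injective.injOn (hlf y)
  let x' : c.supp := ⟨x, rfl⟩
  have hval : ∀ q, (G.induce c.supp).IsRay x' q → G.IsRay x fun n => (q n : V) := fun q hq =>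
    ⟨congrArg Subtype.val hq.zero, hq.adj, fun n h => hq.ne n (Subtype.ext h)⟩
  constructor
  · rw [hG'.ncard_end hc' hlf' x']
    refine Set.ncard_congr (fun q _ n => (q n : V)) hval ?_ ?_
    · intro q q' _ _ h
      exact funext fun n => Subtype.ext (congrFun h n)
    · intro r hr
      have hmem : ∀ n, r n ∈ c.supp := fun n => ConnectedComponent.sound (hr.reachable n).symm
      exact ⟨fun n => ⟨r n, hmem n⟩, ⟨Subtype.ext hr.zero, hr.adj,
        fun n h => hr.ne n (congrArg Subtype.val h)⟩, rfl⟩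
  · intro hne
    obtain ⟨e, he⟩ := Set.nonempty_iff_ne_empty.2 hne
    obtain ⟨q, hq, -⟩ := hG'.exists_isRay_tendsToEnd hc' hlf' x' he
    exact ⟨_, hval q hq⟩

end SimpleGraph

namespace SimpleGraph

universe u

variable {V : Type u} {G : SimpleGraph V}

/-- The edge from `x` to `y` extends to a path with `n` further edges. -/
def Ext (G : SimpleGraph V) : ℕ → V → V → Prop
  | 0, x, y => G.Adj x y
  | n + 1, x, y => G.Adj x y ∧ ∃ z, z ≠ x ∧ G.Ext n y z

/-- The edge from `x` to `y` extends to arbitrarily long paths. -/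
def Rich (G : SimpleGraph V) (x y : V) : Prop := ∀ n, G.Ext n x y

/-- The vertices with at least two rich edges. -/
def richCore (G : SimpleGraph V) : Set V :=
  {x | ∃ y₁ y₂, y₁ ≠ y₂ ∧ G.Rich x y₁ ∧ G.Rich x y₂}

theorem Ext.adj {n : ℕ} {x y : V} (h : G.Ext n x y) : G.Adj x y := by
  cases n with
  | zero => exact h
  | succ n => exact h.1

theorem Ext.of_succ {n : ℕ} {x y : V} (h : G.Ext (n + 1) x y) : G.Ext n x y := by
  induction n generalizing x y with
  | zero => exact h.1
  | succ n ih =>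
    obtain ⟨hadj, z, hz, hyz⟩ := h
    exact ⟨hadj, z, hz, ih hyz⟩

theorem Ext.mono {m n : ℕ} {x y : V} (hmn : m ≤ n) (h : G.Ext n x y) : G.Ext m x y := by
  induction n, hmn using Nat.le_induction with
  | base => exact h
  | succ n _ ih => exact ih h.of_succ

theorem Rich.adj {x y : V} (h : G.Rich x y) : G.Adj x y := h 0

theorem Rich.cons {x y z : V} (h : G.Rich y z) (hadj : G.Adj x y) (hne : z ≠ x) : G.Rich x y := by
  rintro (_ | n)
  · exact hadj
  · exact ⟨hadj, z, hne, h n⟩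

theorem Rich.exists_rich (hlf : ∀ x, (G.neighborSet x).Finite) {x y : V} (h : G.Rich x y) :
    ∃ z, z ≠ x ∧ G.Rich y z := by
  by_contra! hcon
  have : ∀ z, ∃ n, z ≠ x → ¬ G.Ext n y z := fun z => by
    by_cases hz : z = x
    · exact ⟨0, fun h => absurd hz h⟩
    · have := hcon z hz
      simp only [Rich, not_forall] at this
      obtain ⟨n, hn⟩ := this
      exact ⟨n, fun _ => hn⟩
  choose N hN using this
  obtain ⟨-, z, hz, hyz⟩ := h ((hlf y).toFinset.sup N + 1)
  exact hN z hz (hyz.mono (Finset.le_sup (f := N) (by simpa using hyz.adj)))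

theorem rich_of_sequence {q : ℕ → V} (hadj : ∀ n, G.Adj (q n) (q (n + 1)))
    (hne : ∀ n, q (n + 2) ≠ q n) (n : ℕ) : G.Rich (q n) (q (n + 1)) := by
  intro k
  induction k generalizing n with
  | zero => exact hadj n
  | succ k ih => exact ⟨hadj n, _, hne n, ih (n + 1)⟩

theorem IsRay.rich {x : V} {q : ℕ → V} (hq : G.IsRay x q) (n : ℕ) :
    G.Rich (q n) (q (n + 1)) :=
  rich_of_sequence hq.adj hq.ne n

theorem Rich.exists_isRay (hlf : ∀ x, (G.neighborSet x).Finite) {x y : V} (h : G.Rich x y) :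
    ∃ q, G.IsRay x q ∧ q 1 = y := by
  choose s hs hr using fun p : {p : V × V // G.Rich p.1 p.2} => p.2.exists_rich hlf
  let next : {p : V × V // G.Rich p.1 p.2} → {p : V × V // G.Rich p.1 p.2} :=
    fun p => ⟨(p.1.2, s p), hr p⟩
  have hit : ∀ n, next^[n + 1] ⟨(x, y), h⟩ = next (next^[n] ⟨(x, y), h⟩) := fun n =>
    Function.iterate_succ_apply' _ _ _
  refine ⟨fun n => (next^[n] ⟨(x, y), h⟩).1.1, ⟨rfl, fun n => ?_, fun n => ?_⟩, rfl⟩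
  · rw [hit]
    exact (next^[n] ⟨(x, y), h⟩).2.adj
  · rw [hit, hit]
    exact hs _

theorem Rich.symm_of_mem_richCore {x y : V} (hx : x ∈ G.richCore) (hadj : G.Adj x y) :
    G.Rich y x := by
  obtain ⟨y₁, y₂, hne, h₁, h₂⟩ := hx
  by_cases h : y₁ = y
  · exact h₂.cons hadj.symm (h ▸ hne.symm)
  · exact h₁.cons hadj.symm h

theorem Rich.mem_richCore (hlf : ∀ x, (G.neighborSet x).Finite) {x y : V} (h : G.Rich x y)
    (h' : G.Rich y x) : x ∈ G.richCore ∧ y ∈ G.richCore := by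
  obtain ⟨z, hz, hyz⟩ := h.exists_rich hlf
  obtain ⟨w, hw, hxw⟩ := h'.exists_rich hlf
  exact ⟨⟨w, y, hw, hxw, h⟩, ⟨z, x, hz, hyz, h'⟩⟩

theorem not_exists_rich_chain (hlf : ∀ x, (G.neighborSet x).Finite) {f : V → V}
    (hf : ∀ x, G.Rich x (f x)) :
    ¬ ∃ u : ℕ → V, ∀ i, u i ∉ G.richCore ∧ f (u (i + 1)) = u i := by
  rintro ⟨u, hu⟩
  have hr : ∀ i, G.Rich (u (i + 1)) (u i) := fun i => by
    have := hf (u (i + 1))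
    rwa [(hu i).2] at this
  have hne : ∀ i, u (i + 2) ≠ u i := fun i h => by
    have h₁ := hr (i + 1)
    rw [show u (i + 1 + 1) = u i from h] at h₁
    exact (hu i).1 (h₁.mem_richCore hlf (hr i)).1
  exact (hu 0).1 ((hr 0).mem_richCore hlf
    (rich_of_sequence (fun n => (hr n).adj.symm) hne 0)).2

theorem IsRay.mem_richCore (hlf : ∀ x, (G.neighborSet x).Finite) {x : V} {q : ℕ → V}
    (hq : G.IsRay x q) (hx : x ∈ G.richCore) (n : ℕ) : q n ∈ G.richCore := by
  induction n with
  | zero => rwa [hq.zero]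
  | succ n ih =>
    exact ((hq.rich n).mem_richCore hlf (Rich.symm_of_mem_richCore ih (hq.adj n))).2

theorem bushy_richCore (hlf : ∀ x, (G.neighborSet x).Finite)
    (hrays : ∀ x, {q | G.IsRay x q}.ncard ≠ 2) : G.Bushy G.richCore := by
  intro x hx
  have hmem : ∀ {z y}, z ∈ G.richCore → G.Rich z y → y ∈ G.richCore := fun hz h =>
    (h.mem_richCore hlf (Rich.symm_of_mem_richCore hz h.adj)).2
  obtain ⟨y₁, y₂, hne, h₁, h₂⟩ := id hx
  refine ⟨⟨y₁, y₂, ⟨h₁.adj, hx, hmem hx h₁⟩, ⟨h₂.adj, hx, hmem hx h₂⟩, hne⟩, ?_⟩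
  by_contra! hcon
  refine hrays x (Set.ncard_eq_two.2 ?_)
  obtain ⟨q₁, hq₁, e₁⟩ := h₁.exists_isRay hlf
  obtain ⟨q₂, hq₂, e₂⟩ := h₂.exists_isRay hlf
  have hadj : ∀ {q}, G.IsRay x q → ∀ n, (G.restr G.richCore).Adj (q n) (q (n + 1)) :=
    fun hq n => ⟨hq.adj n, hq.mem_richCore hlf hx n, hq.mem_richCore hlf hx (n + 1)⟩
  have hreach : ∀ {q}, G.IsRay x q → ∀ n, (G.restr G.richCore).Reachable x (q n) := by
    intro q hq n
    induction n with
    | zero => rw [hq.zero]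
    | succ n ih => exact ih.trans (hadj hq n).reachable
  have heq : ∀ {q r}, G.IsRay x q → G.IsRay x r → q 1 = r 1 → q = r := by
    intro q r hq hr h
    funext n
    induction n using Nat.twoStepInduction with
    | zero => rw [hq.zero, hr.zero]
    | one => exact h
    | more n i₀ i₁ =>
      by_contra hqr
      refine hcon _ (hreach hq (n + 1)) ⟨q n, q (n + 2), r (n + 2), (hadj hq n).symm,
        hadj hq (n + 1), ?_, (hq.ne n).symm, ?_, hqr⟩
      · have := hadj hr (n + 1)
        rwa [← i₁] at this
      · rw [i₀]
        exact (hr.ne n).symm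
  refine ⟨q₁, q₂, fun h => hne (by rw [← e₁, ← e₂, h]), ?_⟩
  ext r
  simp only [Set.mem_ofPred_eq, Set.mem_insert_iff, Set.mem_singleton_iff]
  refine ⟨fun hr => ?_, ?_⟩
  · by_contra! hqr
    refine hcon x (Reachable.refl x) ⟨q₁ 1, q₂ 1, r 1, ?_, ?_, ?_, by rwa [e₁, e₂],
      fun h => hqr.1 (heq hr hq₁ h.symm), fun h => hqr.2 (heq hr hq₂ h.symm)⟩
    · have := hadj hq₁ 0
      rwa [hq₁.zero] at this
    · have := hadj hq₂ 0
      rwa [hq₂.zero] at this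
    · have := hadj hr 0
      rwa [hr.zero] at this
  · rintro (rfl | rfl)
    exacts [hq₁, hq₂]

end SimpleGraph

section RichPeel

open Set SimpleGraph

variable {X : Type*} [MeasurableSpace X] {G : SimpleGraph X} {h : ℕ → X → X}

theorem EnumeratesComponents.measurable_ext (hh : EnumeratesComponents G h)
    (hadj : Measurable fun p : X × X => G.Adj p.1 p.2)
    (hdiag : Measurable fun p : X × X => p.1 = p.2) (n : ℕ) :
    Measurable fun p : X × X => G.Ext n p.1 p.2 := by
  induction n with
  | zero => exact hadj
  | succ n ih =>
    refine hadj.and (hh.measurable_exists (φ := fun p : X × X => p.2)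
      (Q := fun p z => z ≠ p.1 ∧ G.Ext n p.2 z) measurable_snd ?_ fun p z hz => hz.2.adj.reachable)
    exact (hdiag.comp (measurable_snd.prodMk (measurable_fst.comp measurable_fst))).not.and
      (ih.comp ((measurable_snd.comp measurable_fst).prodMk measurable_snd))

theorem EnumeratesComponents.exists_peel_richCore (hh : EnumeratesComponents G h)
    (hlf : ∀ x, (G.neighborSet x).Finite)
    (hadj : Measurable fun p : X × X => G.Adj p.1 p.2)
    (hdiag : Measurable fun p : X × X => p.1 = p.2) (hrich : ∀ x, ∃ y, G.Rich x y) :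
    ∃ f, Peel G univ G.richCore f := by
  have hm : Measurable fun p : X × X => G.Rich p.1 p.2 :=
    Measurable.forall fun n => hh.measurable_ext hadj hdiag n
  have hmn : ∀ n, Measurable fun x => G.Rich x (h n x) := fun n =>
    hm.comp (measurable_id.prodMk (hh.measurable n))
  obtain ⟨f, hf, hfr⟩ := exists_measurable_choice hh.measurable hmn
  have hrich' : ∀ x, G.Rich x (f x) := fun x => by
    obtain ⟨y, hy⟩ := hrich x
    obtain ⟨n, rfl⟩ := (hh.reachable_iff _ _).1 hy.adj.reachable
    obtain ⟨m, hm, e⟩ := hfr x ⟨n, hy⟩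
    rwa [e]
  refine ⟨f, subset_univ _, ?_, hf, fun v _ => ⟨(hrich' v).adj, mem_univ _⟩, ?_⟩
  · have : G.richCore = {x | ∃ m n, h m x ≠ h n x ∧ G.Rich x (h m x) ∧ G.Rich x (h n x)} := by
      ext x
      constructor
      · rintro ⟨y₁, y₂, hne, h₁, h₂⟩
        obtain ⟨m, rfl⟩ := (hh.reachable_iff _ _).1 h₁.adj.reachable
        obtain ⟨n, rfl⟩ := (hh.reachable_iff _ _).1 h₂.adj.reachable
        exact ⟨m, n, hne, h₁, h₂⟩
      · rintro ⟨m, n, hmn⟩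
        exact ⟨_, _, hmn⟩
    rw [this]
    refine measurableSet_setOfPred.2 (Measurable.exists fun m => Measurable.exists fun n => ?_)
    exact (hdiag.comp ((hh.measurable m).prodMk (hh.measurable n))).not.and
      ((hmn m).and (hmn n))
  · rintro ⟨u, hu⟩
    exact not_exists_rich_chain hlf hrich' ⟨u, fun i => ⟨(hu i).1.2, (hu i).2⟩⟩

end RichPeel

theorem stmt_4 {X : Type*} [mX : MeasurableSpace X] [StandardBorelSpace X]
    (G : SimpleGraph X) (hGmeas : MeasurableSet {p : X × X | G.Adj p.1 p.2})
    (hlf : ∀ x : X, (G.neighborSet x).Finite)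
    (hacyc : G.IsAcyclic)
    (hends : ∀ c : G.ConnectedComponent,
      SimpleGraph.end (G.induce c.supp) ≠ ∅ ∧
        (SimpleGraph.end (G.induce c.supp)).ncard ≠ 2)
    (τ : TopologicalSpace X) (hpolish : @PolishSpace X τ)
    (hcompat : @borel X τ = mX) :
    ∃ B : Set X, MeasurableSet B ∧ B ∈ @residual X τ ∧
      ∃ f : B → X, Measurable f ∧ (∀ x : B, G.Adj (x : X) (f x)) ∧ OneEnded f := by
  let _ := τ
  have := hpolish
  have : BorelSpace X := ⟨hcompat.symm⟩
  have hadj : Measurable fun p : X × X => G.Adj p.1 p.2 := measurableSet_setOfPred.1 hGmeas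
  have hdiag : Measurable fun p : X × X => p.1 = p.2 :=
    measurableSet_setOfPred.1 measurableSet_diagonal
  obtain ⟨h, hh⟩ := exists_enumeratesComponents hGmeas hlf
  have hrich : ∀ x, ∃ y, G.Rich x y := fun x => by
    obtain ⟨q, hq⟩ := (hacyc.ncard_end_induce_supp hlf x).2 (hends _).1
    exact ⟨q 1, hq.zero ▸ hq.rich 0⟩
  have hrays : ∀ x, {q | G.IsRay x q}.ncard ≠ 2 := fun x => by
    rw [← (hacyc.ncard_end_induce_supp hlf x).1]
    exact (hends _).2
  obtain ⟨f₀, hf₀⟩ := hh.exists_peel_richCore hlf hadj hdiag hrich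
  exact exists_comeagre_oneEnded_of_bushy hacyc hlf hadj (SimpleGraph.bushy_richCore hlf hrays) hf₀
end

section
/- Let G be a locally countable Borel graph on a standard Borel space X. Then the following are equivalent: (1) G admits a Borel proper 2-coloring; (2) for every Borel probability measure μ on X, G admits a μ-measurable proper 2-coloring; (3) for every Polish topology τ on X compatible with its Borel structure, G admits a Baire measurable (with respect to τ) proper 2-coloring. -/
open MeasureTheory

section TwoColorings

open Set Topology

/-- A symmetric irreflexive relation such that any two points joined by a `K`-path of length three
are `K`-related: for example the relation of being joined by an odd walk in a bipartite graph. -/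
structure IsOddRelation {X : Type*} (K : X → X → Prop) : Prop where
  symm : ∀ {x y : X}, K x y → K y x
  irrefl : ∀ x : X, ¬ K x x
  comp : ∀ {x y z w : X}, K x y → K y z → K z w → K x w

/-- The set of `K`-neighbors of points of `A`. -/
def relNeighbors {X : Type*} (K : X → X → Prop) (A : Set X) : Set X :=
  {y | ∃ x ∈ A, K x y}

/-- No two points of `A` are `K`-related. -/
def RelIndependent {X : Type*} (K : X → X → Prop) (A : Set X) : Prop :=
  ∀ x ∈ A, ∀ y ∈ A, ¬ K x y

/-- `A` is covered by countably many measurable `K`-independent sets. -/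
def CountablyRelColorable {X : Type*} [MeasurableSpace X] (K : X → X → Prop) (A : Set X) : Prop :=
  ∃ 𝓑 : Set (Set X), 𝓑.Countable ∧ (∀ B ∈ 𝓑, MeasurableSet B ∧ RelIndependent K B) ∧ A ⊆ ⋃₀ 𝓑

section Ideal

variable {X : Type*} [MeasurableSpace X] {K : X → X → Prop}

theorem CountablyRelColorable.mono {A B : Set X} (hB : CountablyRelColorable K B) (h : A ⊆ B) :
    CountablyRelColorable K A := by
  obtain ⟨𝓑, h1, h2, h3⟩ := hB
  exact ⟨𝓑, h1, h2, h.trans h3⟩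

theorem CountablyRelColorable.biUnion {ι : Type*} {t : Set ι} (ht : t.Countable) {A : ι → Set X}
    (h : ∀ i ∈ t, CountablyRelColorable K (A i)) : CountablyRelColorable K (⋃ i ∈ t, A i) := by
  choose! 𝓑 h1 h2 h3 using h
  refine ⟨⋃ i ∈ t, 𝓑 i, ht.biUnion h1, ?_, ?_⟩
  · intro B hB
    simp only [mem_iUnion] at hB
    obtain ⟨i, hi, hB⟩ := hB
    exact h2 i hi B hB
  · intro x hx
    simp only [mem_iUnion] at hx
    obtain ⟨i, hi, hx⟩ := hx
    obtain ⟨B, hB, hxB⟩ := h3 i hi hx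
    exact ⟨B, mem_biUnion hi hB, hxB⟩

theorem CountablyRelColorable.union {A B : Set X} (hA : CountablyRelColorable K A)
    (hB : CountablyRelColorable K B) : CountablyRelColorable K (A ∪ B) := by
  obtain ⟨𝓐, a1, a2, a3⟩ := hA
  obtain ⟨𝓑, b1, b2, b3⟩ := hB
  refine ⟨𝓐 ∪ 𝓑, a1.union b1, ?_, ?_⟩
  · rintro C (hC | hC)
    exacts [a2 C hC, b2 C hC]
  · rw [sUnion_union]
    exact union_subset_union a3 b3

theorem CountablyRelColorable.of_measurable {A : Set X} (hA : MeasurableSet A)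
    (h : RelIndependent K A) : CountablyRelColorable K A :=
  ⟨{A}, countable_singleton A, by simpa using ⟨hA, h⟩, by simp⟩

end Ideal

section Reflection

variable {X : Type*} [TopologicalSpace X] [PolishSpace X] {K : X → X → Prop}

theorem MeasureTheory.AnalyticSet.inter {Y : Type*} [TopologicalSpace Y] [T2Space Y] {s t : Set Y}
    (hs : AnalyticSet s) (ht : AnalyticSet t) : AnalyticSet (s ∩ t) := by
  rw [inter_eq_iInter]
  exact AnalyticSet.iInter (by rintro (_ | _) <;> assumption)

theorem MeasureTheory.AnalyticSet.union {Y : Type*} [TopologicalSpace Y] {s t : Set Y}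
    (hs : AnalyticSet s) (ht : AnalyticSet t) : AnalyticSet (s ∪ t) := by
  rw [union_eq_iUnion]
  exact AnalyticSet.iUnion (by rintro (_ | _) <;> assumption)

theorem analyticSet_relNeighbors (hKa : AnalyticSet {p : X × X | K p.1 p.2}) {A : Set X}
    (hA : AnalyticSet A) : AnalyticSet (relNeighbors K A) := by
  have : relNeighbors K A = Prod.snd '' ({p : X × X | K p.1 p.2} ∩ Prod.fst ⁻¹' A) := by
    ext y
    simp only [relNeighbors, mem_ofPred_eq, mem_image, mem_inter_iff, mem_preimage, Prod.exists]
    exact ⟨fun ⟨x, hx, hxy⟩ => ⟨x, y, ⟨hxy, hx⟩, rfl⟩, fun ⟨x, _, ⟨h, hx⟩, e⟩ => ⟨x, hx, e ▸ h⟩⟩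
  rw [this]
  exact (hKa.inter (hA.preimage continuous_fst)).image_of_continuous continuous_snd

variable [MeasurableSpace X] [BorelSpace X]

/-- Analytic independent sets are contained in Borel independent sets. -/
theorem exists_measurable_relIndependent (hK : IsOddRelation K)
    (hKa : AnalyticSet {p : X × X | K p.1 p.2}) {A : Set X} (hA : AnalyticSet A)
    (hi : RelIndependent K A) :
    ∃ B, A ⊆ B ∧ MeasurableSet B ∧ RelIndependent K B := by
  obtain ⟨B, hAB, hB, hBm⟩ := hA.measurablySeparable (analyticSet_relNeighbors hKa hA)
    (disjoint_left.2 fun y hy ⟨x, hx, hxy⟩ => hi x hx y hy hxy)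
  obtain ⟨C, hAC, hC, hCm⟩ := hA.measurablySeparable
    (analyticSet_relNeighbors hKa hBm.analyticSet)
    (disjoint_left.2 fun y hy ⟨x, hx, hxy⟩ => disjoint_left.1 hB ⟨y, hy, hK.symm hxy⟩ hx)
  exact ⟨B ∩ C, subset_inter hAB hAC, hBm.inter hCm,
    fun x hx y hy hxy => disjoint_left.1 hC ⟨x, hx.1, hxy⟩ hy.2⟩

/-- Analytic independent sets are contained in Borel independent sets which are closed under
paths of length two. -/
theorem exists_measurable_relIndependent_saturated (hK : IsOddRelation K)
    (hKa : AnalyticSet {p : X × X | K p.1 p.2}) {A : Set X} (hA : MeasurableSet A)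
    (hi : RelIndependent K A) :
    ∃ B, A ⊆ B ∧ MeasurableSet B ∧ RelIndependent K B ∧
      ∀ x y z, x ∈ B → K x y → K y z → z ∈ B := by
  have step : ∀ C : {C : Set X // MeasurableSet C ∧ RelIndependent K C},
      ∃ D : {C : Set X // MeasurableSet C ∧ RelIndependent K C},
        C.1 ∪ relNeighbors K (relNeighbors K C.1) ⊆ D.1 := by
    rintro ⟨C, hC, hCi⟩
    obtain ⟨D, hD, hDm, hDi⟩ := exists_measurable_relIndependent hK hKa
      (hC.analyticSet.union
        (analyticSet_relNeighbors hKa (analyticSet_relNeighbors hKa hC.analyticSet))) (by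
        rintro x (hx | ⟨y, ⟨x', hx', h1⟩, h2⟩) z (hz | ⟨w, ⟨z', hz', h3⟩, h4⟩) hxz
        · exact hCi x hx z hz hxz
        · exact hCi z' hz' x hx (hK.comp h3 h4 (hK.symm hxz))
        · exact hCi x' hx' z hz (hK.comp h1 h2 hxz)
        · exact hCi x' hx' z' hz'
            (hK.comp (hK.comp h1 h2 hxz) (hK.symm h4) (hK.symm h3)))
    exact ⟨⟨D, hDm, hDi⟩, hD⟩
  choose F hF using step
  let S : ℕ → {C : Set X // MeasurableSet C ∧ RelIndependent K C} :=
    fun n => F^[n] ⟨A, hA, hi⟩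
  have hS : ∀ n, S (n + 1) = F (S n) := fun n => Function.iterate_succ_apply' F n _
  have hmono : Monotone fun n => (S n).1 := monotone_nat_of_le_succ fun n => by
    rw [hS]
    exact subset_union_left.trans (hF (S n))
  refine ⟨⋃ n, (S n).1, subset_iUnion (fun n => (S n).1) 0,
    MeasurableSet.iUnion fun n => (S n).2.1, ?_, ?_⟩
  · intro x hx y hy hxy
    obtain ⟨m, hm⟩ := mem_iUnion.1 hx
    obtain ⟨n, hn⟩ := mem_iUnion.1 hy
    exact (S (max m n)).2.2 x (hmono (le_max_left m n) hm) y (hmono (le_max_right m n) hn) hxy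
  · intro x y z hx hxy hyz
    obtain ⟨m, hm⟩ := mem_iUnion.1 hx
    refine mem_iUnion.2 ⟨m + 1, ?_⟩
    rw [hS]
    exact hF (S m) (Or.inr ⟨y, ⟨x, hm, hxy⟩, hyz⟩)

/-- A Borel coloring of an odd relation with countably many colors yields a Borel 2-coloring. -/
theorem CountablyRelColorable.exists_measurable_two_coloring (hK : IsOddRelation K)
    (hKa : AnalyticSet {p : X × X | K p.1 p.2}) (h : CountablyRelColorable K (univ : Set X)) :
    ∃ c : X → Fin 2, Measurable c ∧ ∀ x y, K x y → c x ≠ c y := by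
  classical
  obtain ⟨𝓑, h𝓑, hB, hcov⟩ := h
  obtain ⟨B, hBr⟩ := (h𝓑.insert ∅).exists_eq_range (insert_nonempty _ _)
  have hB' : ∀ n, MeasurableSet (B n) ∧ RelIndependent K (B n) := by
    intro n
    have : B n ∈ insert ∅ 𝓑 := hBr ▸ mem_range_self n
    rcases this with h | h
    · rw [h]
      exact ⟨MeasurableSet.empty, fun x hx => hx.elim⟩
    · exact hB _ h
  have hcov' : ∀ x, ∃ n, x ∈ B n := by
    intro x
    obtain ⟨C, hC, hx⟩ := hcov (mem_univ x)
    obtain ⟨n, rfl⟩ : C ∈ range B := hBr ▸ Or.inr hC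
    exact ⟨n, hx⟩
  choose C hBC hCm hCi hCs using fun n =>
    exists_measurable_relIndependent_saturated hK hKa (hB' n).1 (hB' n).2
  have hcovC : ∀ x, ∃ n, x ∈ C n := fun x => (hcov' x).imp fun n hn => hBC n hn
  let p : X → ℕ := fun x => Nat.find (hcovC x)
  have hp : Measurable p := measurable_find hcovC hCm
  have hpK : ∀ x y, K x y → p x ≠ p y := fun x y hxy he => by
    have h1 : x ∈ C (p x) := Nat.find_spec (hcovC x)
    have h2 : y ∈ C (p x) := he ▸ Nat.find_spec (hcovC y)
    exact hCi _ x h1 y h2 hxy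
  have hpE : ∀ x y z, K x y → K x z → p y = p z := by
    have key : ∀ x y z, K x y → K x z → p y ≤ p z := fun x y z hy hz =>
      Nat.find_min' _ (hCs _ z x y (Nat.find_spec (hcovC z)) (hK.symm hz) hy)
    exact fun x y z hy hz => le_antisymm (key x y z hy hz) (key x z y hz hy)
  have han : ∀ s : Set (X × X), MeasurableSet s →
      AnalyticSet {x | ∃ y, K x y ∧ (x, y) ∈ s} := by
    intro s hs
    have : {x | ∃ y, K x y ∧ (x, y) ∈ s} = Prod.fst '' ({q : X × X | K q.1 q.2} ∩ s) := by
      ext x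
      simp
    rw [this]
    exact (hKa.inter hs.analyticSet).image_of_continuous continuous_fst
  obtain ⟨D, hD1, hD2, hDm⟩ := (han {q | p q.1 < p q.2}
      (measurableSet_lt (hp.comp measurable_fst) (hp.comp measurable_snd))).measurablySeparable
    (han {q | p q.2 < p q.1}
      (measurableSet_lt (hp.comp measurable_snd) (hp.comp measurable_fst)))
    (disjoint_left.2 fun x ⟨y, hy, h1⟩ ⟨z, hz, h2⟩ => by
      have := hpE x y z hy hz
      simp only [mem_ofPred_eq] at h1 h2
      omega)
  have hlt : ∀ x y, K x y → p x < p y → x ∈ D ∧ y ∉ D := fun x y hxy h =>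
    ⟨hD1 ⟨y, hxy, h⟩, fun hy => disjoint_left.1 hD2 ⟨x, hK.symm hxy, h⟩ hy⟩
  refine ⟨fun x => if x ∈ D then 0 else 1,
    Measurable.ite hDm measurable_const measurable_const, fun x y hxy => ?_⟩
  rcases lt_or_gt_of_ne (hpK x y hxy) with h | h
  · obtain ⟨h1, h2⟩ := hlt x y hxy h
    simp [h1, h2]
  · obtain ⟨h1, h2⟩ := hlt y x (hK.symm hxy) h
    simp [h1, h2]

theorem not_countablyRelColorable_inter_relNeighbors (hK : IsOddRelation K)
    (hKa : AnalyticSet {p : X × X | K p.1 p.2}) {A : Set X} (hA : AnalyticSet A)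
    (h : ¬ CountablyRelColorable K A) : ¬ CountablyRelColorable K (A ∩ relNeighbors K A) := by
  rintro ⟨𝓑, h𝓑, hB, hsub⟩
  have hm : MeasurableSet (⋃₀ 𝓑) := MeasurableSet.sUnion h𝓑 fun B hB' => (hB B hB').1
  obtain ⟨C, hC, hCm, hCi⟩ := exists_measurable_relIndependent hK hKa
    (hA.inter hm.compl.analyticSet)
    (fun x hx y hy hxy => hy.2 (hsub ⟨hy.1, x, hx.1, hxy⟩))
  refine h (CountablyRelColorable.mono
    (CountablyRelColorable.union ⟨𝓑, h𝓑, hB, subset_rfl⟩ (.of_measurable hCm hCi)) fun x hx => ?_)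
  by_cases hx' : x ∈ ⋃₀ 𝓑
  · exact Or.inl hx'
  · exact Or.inr (hC ⟨hx, hx'⟩)

end Reflection

section Scheme

variable {X : Type*} [TopologicalSpace X] [PolishSpace X] [MeasurableSpace X] [BorelSpace X]
  {K : X → X → Prop}

/-- Data describing a family of configurations, parametrized by the Baire space: `base` is a
distinguished vertex of the configuration, `vertices` are all vertices, and `params` are the maps
to parameters of earlier configurations. -/
structure ConfigFamily (K : X → X → Prop) where
  base : (ℕ → ℕ) → X
  params : Set ((ℕ → ℕ) → (ℕ → ℕ))
  vertices : Set ((ℕ → ℕ) → X)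
  continuous_base : Continuous base
  finite_params : params.Finite
  continuous_params : ∀ f ∈ params, Continuous f
  finite_vertices : vertices.Finite
  continuous_vertices : ∀ f ∈ vertices, Continuous f
  rel_vertices : ∀ f ∈ vertices, ∀ a b, K (base a) (base b) → K (f a) (f b)
  large : ¬ CountablyRelColorable K (range base)

theorem exists_refinement (hK : IsOddRelation K) (hKa : AnalyticSet {p : X × X | K p.1 p.2})
    (s : ConfigFamily K) (N : ℕ) :
    ∃ ρ : Bool → (ℕ → ℕ) → (ℕ → ℕ), (∀ b, Continuous (ρ b)) ∧
      (∀ h, K (s.base (ρ false h)) (s.base (ρ true h))) ∧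
      (∀ b, ∀ f ∈ s.params, ∀ h h', ∀ j < N, f (ρ b h) j = f (ρ b h') j) ∧
      (∀ f ∈ s.vertices, ∀ h h', f (ρ false h) ≠ f (ρ true h')) ∧
      ¬ CountablyRelColorable K (range (s.base ∘ ρ false)) := by
  let Z : Set ((ℕ → ℕ) × (ℕ → ℕ)) := {p | K (s.base p.1) (s.base p.2)}
  have hZ : AnalyticSet Z := hKa.preimage
    ((s.continuous_base.comp continuous_fst).prodMk (s.continuous_base.comp continuous_snd))
  have hU : ∀ z ∈ Z, ∃ U : Set ((ℕ → ℕ) × (ℕ → ℕ)), IsOpen U ∧ z ∈ U ∧ ∀ p ∈ U, ∀ q ∈ U,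
      (∀ f ∈ s.params, ∀ j < N, f p.1 j = f q.1 j ∧ f p.2 j = f q.2 j) ∧
      ∀ f ∈ s.vertices, f p.1 ≠ f q.2 := by
    intro z hz
    have h1 : ∀ᶠ r : ((ℕ → ℕ) × (ℕ → ℕ)) × ((ℕ → ℕ) × (ℕ → ℕ)) in 𝓝 (z, z),
        ∀ f ∈ s.params, ∀ j ∈ Finset.range N, f r.1.1 j = f r.2.1 j ∧ f r.1.2 j = f r.2.2 j := by
      refine (Filter.eventually_all_finite s.finite_params).2 fun f hf =>
        (Filter.eventually_all_finset _).2 fun j _ => ?_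
      have hc : Continuous fun y => f y j :=
        (continuous_apply j).comp (s.continuous_params f hf)
      refine Filter.Eventually.and ?_ ?_
      · exact ((isOpen_discrete {p : ℕ × ℕ | p.1 = p.2}).preimage
          ((hc.comp (continuous_fst.comp continuous_fst)).prodMk
            (hc.comp (continuous_fst.comp continuous_snd)))).mem_nhds rfl
      · exact ((isOpen_discrete {p : ℕ × ℕ | p.1 = p.2}).preimage
          ((hc.comp (continuous_snd.comp continuous_fst)).prodMk
            (hc.comp (continuous_snd.comp continuous_snd)))).mem_nhds rfl
    have h2 : ∀ᶠ r : ((ℕ → ℕ) × (ℕ → ℕ)) × ((ℕ → ℕ) × (ℕ → ℕ)) in 𝓝 (z, z),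
        ∀ f ∈ s.vertices, f r.1.1 ≠ f r.2.2 := by
      refine (Filter.eventually_all_finite s.finite_vertices).2 fun f hf => ?_
      have hc := s.continuous_vertices f hf
      refine (isOpen_ne_fun (hc.comp (continuous_fst.comp continuous_fst))
        (hc.comp (continuous_snd.comp continuous_snd))).mem_nhds ?_
      exact fun he => hK.irrefl (f z.1) (by
        have := s.rel_vertices f hf z.1 z.2 hz
        change f z.1 = f z.2 at he
        rwa [← he] at this)
    have h3 := h1.and h2
    rw [nhds_prod_eq, Filter.eventually_iff, Filter.mem_prod_self_iff] at h3
    obtain ⟨U, hU, h⟩ := h3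
    obtain ⟨V, hVU, hV, hzV⟩ := mem_nhds_iff.1 hU
    refine ⟨V, hV, hzV, fun p hp q hq => ?_⟩
    obtain ⟨ha, hb⟩ := h (show (p, q) ∈ U ×ˢ U from ⟨hVU hp, hVU hq⟩)
    exact ⟨fun f hf j hj => ha f hf j (Finset.mem_range.2 hj), hb⟩
  choose! U hUo hzU hU using hU
  obtain ⟨t, htZ, htc, hcov⟩ := TopologicalSpace.countable_cover_nhdsWithin
    (f := U) (s := Z) fun z hz => mem_nhdsWithin_of_mem_nhds ((hUo z hz).mem_nhds (hzU z hz))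
  have hlarge : ¬ CountablyRelColorable K
      (⋃ z ∈ t, (fun p : (ℕ → ℕ) × (ℕ → ℕ) => s.base p.1) '' (Z ∩ U z)) := by
    refine fun hc => not_countablyRelColorable_inter_relNeighbors hK hKa
      (analyticSet_range_of_polishSpace s.continuous_base) s.large (hc.mono ?_)
    rintro _ ⟨⟨a, rfl⟩, _, ⟨b, rfl⟩, hab⟩
    have hz : (a, b) ∈ Z := hK.symm hab
    obtain ⟨z, hzt, hzU⟩ := mem_iUnion₂.1 (hcov hz)
    exact mem_iUnion₂.2 ⟨z, hzt, (a, b), ⟨hz, hzU⟩, rfl⟩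
  obtain ⟨z, hzt, hz⟩ : ∃ z ∈ t, ¬ CountablyRelColorable K
      ((fun p : (ℕ → ℕ) × (ℕ → ℕ) => s.base p.1) '' (Z ∩ U z)) := by
    by_contra! hc
    exact hlarge (CountablyRelColorable.biUnion htc hc)
  have hZU := hZ.inter (hUo z (htZ hzt)).measurableSet.analyticSet
  rw [AnalyticSet] at hZU
  rcases hZU with he | ⟨σ, hσ, hr⟩
  · rw [he, image_empty] at hz
    exact (hz ⟨∅, countable_empty, by simp, by simp⟩).elim
  have hmem : ∀ h, σ h ∈ Z ∩ U z := fun h => hr ▸ mem_range_self h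
  refine ⟨fun b h => cond b (σ h).2 (σ h).1, ?_, fun h => (hmem h).1, ?_, ?_, ?_⟩
  · rintro (_ | _)
    exacts [continuous_fst.comp hσ, continuous_snd.comp hσ]
  · rintro (_ | _) f hf h h' j hj
    exacts [((hU z (htZ hzt) _ (hmem h).2 _ (hmem h').2).1 f hf j hj).1,
      ((hU z (htZ hzt) _ (hmem h).2 _ (hmem h').2).1 f hf j hj).2]
  · exact fun f hf h h' => (hU z (htZ hzt) _ (hmem h).2 _ (hmem h').2).2 f hf
  · rw [← hr, ← range_comp] at hz
    exact hz

/-- Every large family of configurations of `K` admits a sequence of refinements. -/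
theorem exists_refinement_sequence (hK : IsOddRelation K)
    (hKa : AnalyticSet {p : X × X | K p.1 p.2}) (s₀ : ConfigFamily K) :
    ∃ (s : ℕ → ConfigFamily K) (ρ : ℕ → Bool → (ℕ → ℕ) → (ℕ → ℕ)), s 0 = s₀ ∧
      (∀ n b, Continuous (ρ n b)) ∧
      (∀ n, (s (n + 1)).base = (s n).base ∘ ρ n false) ∧
      (∀ n, id ∈ (s (n + 1)).params) ∧
      (∀ n b, ∀ f ∈ (s n).params, f ∘ ρ n b ∈ (s (n + 1)).params) ∧
      (∀ n b, ∀ f ∈ (s n).vertices, f ∘ ρ n b ∈ (s (n + 1)).vertices) ∧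
      (∀ n h, K ((s n).base (ρ n false h)) ((s n).base (ρ n true h))) ∧
      (∀ n b, ∀ f ∈ (s n).params, ∀ h h', ∀ j < n, f (ρ n b h) j = f (ρ n b h') j) ∧
      (∀ n, ∀ f ∈ (s n).vertices, ∀ h h', f (ρ n false h) ≠ f (ρ n true h')) := by
  choose ρ hc hb hp hv hl using exists_refinement hK hKa
  let next (s : ConfigFamily K) (N : ℕ) : ConfigFamily K :=
    { base := s.base ∘ ρ s N false
      params := insert id (⋃ b, (fun f => f ∘ ρ s N b) '' s.params)
      vertices := ⋃ b, (fun f => f ∘ ρ s N b) '' s.vertices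
      continuous_base := s.continuous_base.comp (hc s N false)
      finite_params := (finite_iUnion fun b => s.finite_params.image _).insert _
      continuous_params := by
        rintro f (rfl | hf)
        · exact continuous_id
        · obtain ⟨b, g, hg, rfl⟩ := mem_iUnion.1 hf
          exact (s.continuous_params g hg).comp (hc s N b)
      finite_vertices := finite_iUnion fun b => s.finite_vertices.image _
      continuous_vertices := by
        intro f hf
        obtain ⟨b, g, hg, rfl⟩ := mem_iUnion.1 hf
        exact (s.continuous_vertices g hg).comp (hc s N b)
      rel_vertices := by
        intro f hf x y hxy
        obtain ⟨b, g, hg, rfl⟩ := mem_iUnion.1 hf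
        refine s.rel_vertices g hg _ _ ?_
        cases b
        · exact hxy
        · exact hK.comp (hK.symm (hb s N x)) hxy (hb s N y)
      large := hl s N }
  let s : ℕ → ConfigFamily K := fun n => Nat.rec s₀ (fun n t => next t n) n
  refine ⟨s, fun n => ρ (s n) n, rfl, fun n => hc _ _, fun n => rfl, fun n => Or.inl rfl,
    fun n b f hf => Or.inr (mem_iUnion.2 ⟨b, f, hf, rfl⟩),
    fun n b f hf => mem_iUnion.2 ⟨b, f, hf, rfl⟩, fun n => hb _ _, fun n => hp _ _,
    fun n => hv _ _⟩

end Scheme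

section Limit

/-- The composition `ρ k (x k) ∘ ρ (k + 1) (x (k + 1)) ∘ ⋯` of length `m`. -/
def branchComp {α : Type*} (ρ : ℕ → Bool → α → α) (x : ℕ → Bool) (k : ℕ) : ℕ → α → α
  | 0 => id
  | m + 1 => branchComp ρ x k m ∘ ρ (k + m) (x (k + m))

theorem branchComp_succ' {α : Type*} (ρ : ℕ → Bool → α → α) (x : ℕ → Bool) (k m : ℕ) :
    branchComp ρ x k (m + 1) = ρ k (x k) ∘ branchComp ρ x (k + 1) m := by
  induction m with
  | zero => rfl
  | succ m ih =>
    rw [branchComp, ih, branchComp, Function.comp_assoc, Nat.add_right_comm k 1 m]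
    rfl

theorem branchComp_congr {α : Type*} (ρ : ℕ → Bool → α → α) {x x' : ℕ → Bool} (k m : ℕ)
    (h : ∀ i, k ≤ i → i < k + m → x i = x' i) : branchComp ρ x k m = branchComp ρ x' k m := by
  induction m with
  | zero => rfl
  | succ m ih =>
    rw [branchComp, branchComp, ih fun i hi hi' => h i hi (by omega),
      h (k + m) (by omega) (by omega)]

/-- The limit of `branchComp ρ x k m` as `m` tends to infinity, for contracting systems. -/
def branchLimit (ρ : ℕ → Bool → (ℕ → ℕ) → (ℕ → ℕ)) (x : ℕ → Bool) (k : ℕ) : ℕ → ℕ :=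
  fun j => branchComp ρ x k (j + 2) 0 j

theorem branchLimit_congr (ρ : ℕ → Bool → (ℕ → ℕ) → (ℕ → ℕ)) {x x' : ℕ → Bool} (k : ℕ)
    (h : ∀ i, k ≤ i → x i = x' i) : branchLimit ρ x k = branchLimit ρ x' k := by
  funext j
  rw [branchLimit, branchLimit, branchComp_congr ρ k (j + 2) fun i hi _ => h i hi]

theorem continuous_branchLimit (ρ : ℕ → Bool → (ℕ → ℕ) → (ℕ → ℕ)) (k : ℕ) :
    Continuous fun x => branchLimit ρ x k := by
  refine continuous_pi fun j => IsLocallyConstant.continuous ?_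
  rw [IsLocallyConstant.iff_eventually_eq]
  intro x
  have : ∀ᶠ y : ℕ → Bool in 𝓝 x, ∀ i ∈ Finset.range (k + (j + 2)), y i = x i :=
    (Filter.eventually_all_finset _).2 fun i _ =>
      ((isOpen_discrete ({x i} : Set Bool)).preimage
        (continuous_apply (A := fun _ : ℕ => Bool) i)).mem_nhds rfl
  filter_upwards [this] with y hy
  rw [branchLimit, branchLimit,
    branchComp_congr ρ k (j + 2) fun i _ hi => hy i (Finset.mem_range.2 hi)]

variable {ρ : ℕ → Bool → (ℕ → ℕ) → (ℕ → ℕ)} {P : ℕ → Set ((ℕ → ℕ) → (ℕ → ℕ))}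

theorem branchComp_mem (hid : ∀ n, id ∈ P n) (hP : ∀ n b, ∀ f ∈ P n, f ∘ ρ n b ∈ P (n + 1))
    (x : ℕ → Bool) (k m : ℕ) : branchComp ρ x k m ∈ P (k + m) := by
  induction m with
  | zero => exact hid _
  | succ m ih => exact hP _ _ _ ih

theorem branchComp_apply_eq_branchLimit (hid : ∀ n, id ∈ P n)
    (hP : ∀ n b, ∀ f ∈ P n, f ∘ ρ n b ∈ P (n + 1))
    (hcontr : ∀ n b, ∀ f ∈ P n, ∀ h h', ∀ j < n, f (ρ n b h) j = f (ρ n b h') j)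
    (x : ℕ → Bool) (k j m : ℕ) (hm : j + 2 ≤ m) (h : ℕ → ℕ) :
    branchComp ρ x k m h j = branchLimit ρ x k j := by
  induction m, hm using Nat.le_induction generalizing h with
  | base => exact hcontr _ _ _ (branchComp_mem hid hP x k (j + 1)) _ _ j (by omega)
  | succ m _ ih => exact ih _

theorem branchLimit_eq (hid : ∀ n, id ∈ P n)
    (hP : ∀ n b, ∀ f ∈ P n, f ∘ ρ n b ∈ P (n + 1))
    (hcontr : ∀ n b, ∀ f ∈ P n, ∀ h h', ∀ j < n, f (ρ n b h) j = f (ρ n b h') j)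
    (hρ : ∀ n b, Continuous (ρ n b)) (x : ℕ → Bool) (k : ℕ) :
    branchLimit ρ x k = ρ k (x k) (branchLimit ρ x (k + 1)) := by
  have lim : ∀ k, Filter.Tendsto (fun m => branchComp ρ x k m 0) Filter.atTop
      (𝓝 (branchLimit ρ x k)) := fun k => tendsto_pi_nhds.2 fun j =>
    tendsto_const_nhds.congr' (by
      filter_upwards [Filter.eventually_ge_atTop (j + 2)] with m hm
      exact (branchComp_apply_eq_branchLimit hid hP hcontr x k j m hm 0).symm)
  refine tendsto_nhds_unique ((Filter.tendsto_add_atTop_iff_nat 1).2 (lim k)) ?_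
  simp_rw [branchComp_succ']
  exact ((hρ k (x k)).tendsto _).comp (lim (k + 1))

theorem branchLimit_zero_eq (hid : ∀ n, id ∈ P n)
    (hP : ∀ n b, ∀ f ∈ P n, f ∘ ρ n b ∈ P (n + 1))
    (hcontr : ∀ n b, ∀ f ∈ P n, ∀ h h', ∀ j < n, f (ρ n b h) j = f (ρ n b h') j)
    (hρ : ∀ n b, Continuous (ρ n b)) (x : ℕ → Bool) (n : ℕ) :
    branchLimit ρ x 0 = branchComp ρ x 0 n (ρ n (x n) (branchLimit ρ x (n + 1))) := by
  rw [← branchLimit_eq hid hP hcontr hρ]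
  induction n with
  | zero => rfl
  | succ n ih =>
    rw [ih, branchLimit_eq hid hP hcontr hρ x n, branchComp, zero_add]
    rfl

end Limit

/-- The point of the Cantor space obtained from `x` by flipping the `n`-th bit. -/
def flipBit (n : ℕ) (x : ℕ → Bool) : ℕ → Bool :=
  fun i => if i = n then !x i else x i

section Embedding

variable {X : Type*} [TopologicalSpace X] [PolishSpace X] [MeasurableSpace X] [BorelSpace X]
  {K : X → X → Prop}

/-- If an analytic odd relation admits no Borel 2-coloring, then it contains a continuous injective
copy of the graph on the Cantor space connecting points that differ in exactly one bit. -/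
theorem exists_continuous_injective_flipBit (hK : IsOddRelation K)
    (hKa : AnalyticSet {p : X × X | K p.1 p.2})
    (hc : ¬ ∃ c : X → Fin 2, Measurable c ∧ ∀ x y, K x y → c x ≠ c y) :
    ∃ φ : (ℕ → Bool) → X, Continuous φ ∧ Function.Injective φ ∧
      ∀ n x, K (φ x) (φ (flipBit n x)) := by
  have hl : ¬ CountablyRelColorable K (univ : Set X) :=
    fun h => hc (h.exists_measurable_two_coloring hK hKa)
  have hne : Nonempty X := by
    by_contra hX
    rw [not_nonempty_iff] at hX
    exact hl ⟨∅, countable_empty, by simp, fun x => isEmptyElim x⟩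
  obtain ⟨v, hv, hvs⟩ := PolishSpace.exists_nat_nat_continuous_surjective X
  obtain ⟨s, ρ, h0, hρ, hbase, hid, hP, hV, hbK, hcontr, hne⟩ := exists_refinement_sequence hK hKa
    { base := v
      params := {id}
      vertices := {v}
      continuous_base := hv
      finite_params := finite_singleton _
      continuous_params := by
        rintro _ rfl
        exact continuous_id
      finite_vertices := finite_singleton _
      continuous_vertices := by
        rintro _ rfl
        exact hv
      rel_vertices := by
        rintro _ rfl a b h
        exact h
      large := by rwa [hvs.range_eq] }
  have hid' : ∀ n, id ∈ (s n).params := by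
    rintro (_ | n)
    · rw [h0]
      rfl
    · exact hid n
  have hmem : ∀ x n, v ∘ branchComp ρ x 0 n ∈ (s n).vertices := by
    intro x n
    induction n with
    | zero =>
      rw [h0]
      rfl
    | succ n ih =>
      rw [branchComp, zero_add]
      exact hV n _ _ ih
  have key := branchLimit_zero_eq (P := fun n => (s n).params) hid' hP hcontr hρ
  refine ⟨fun x => v (branchLimit ρ x 0), hv.comp (continuous_branchLimit ρ 0), ?_, ?_⟩
  · intro x x' hxx
    by_contra hne'
    obtain ⟨n, hn, hmin⟩ : ∃ n, x n ≠ x' n ∧ ∀ i < n, x i = x' i := by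
      classical
      have hex : ∃ n, x n ≠ x' n := Function.ne_iff.1 hne'
      exact ⟨Nat.find hex, Nat.find_spec hex, fun i hi => not_not.1 (Nat.find_min hex hi)⟩
    simp only at hxx
    rw [key x n, key x' n, ← branchComp_congr ρ 0 n fun i _ hi => hmin i (by omega)] at hxx
    have h1 := hne n _ (hmem x n)
    rcases hb : x n with _ | _ <;> rcases hb' : x' n with _ | _ <;> rw [hb, hb'] at hxx hn
    · exact hn rfl
    · exact h1 _ _ hxx
    · exact h1 _ _ hxx.symm
    · exact hn rfl
  · intro n x
    have hb : ∀ y, K (v (branchComp ρ x 0 n (ρ n false y))) (v (branchComp ρ x 0 n (ρ n true y))) :=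
      fun y => (s n).rel_vertices _ (hmem x n) _ _ (hbK n y)
    have e1 : branchComp ρ (flipBit n x) 0 n = branchComp ρ x 0 n :=
      branchComp_congr ρ 0 n fun i _ hi => if_neg (by omega)
    have e2 : branchLimit ρ (flipBit n x) (n + 1) = branchLimit ρ x (n + 1) :=
      branchLimit_congr ρ (n + 1) fun i hi => if_neg (by omega)
    have e3 : flipBit n x n = !x n := if_pos rfl
    simp only
    rw [key x n, key (flipBit n x) n, e1, e2, e3]
    rcases x n with _ | _
    · exact hb _
    · exact hK.symm (hb _)

end Embedding

section OddWalk

/-- The relation of being joined by a walk of odd length. -/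
def OddWalkRel {X : Type*} (G : SimpleGraph X) (x y : X) : Prop :=
  ∃ p : G.Walk x y, Odd p.length

variable {X : Type*} {G : SimpleGraph X}

theorem OddWalkRel.of_adj {x y : X} (h : G.Adj x y) : OddWalkRel G x y :=
  ⟨h.toWalk, by simp⟩

theorem OddWalkRel.ne {c : X → Fin 2} (hc : ∀ x y, G.Adj x y → c x ≠ c y) {x y : X}
    (h : OddWalkRel G x y) : c x ≠ c y := by
  obtain ⟨p, hp⟩ := h
  have key : ∀ {x y : X} (p : G.Walk x y), c x ≠ c y ↔ Odd p.length := by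
    intro x y p
    induction p with
    | nil => simp
    | cons h p ih =>
      have := hc _ _ h
      rw [SimpleGraph.Walk.length_cons, Nat.odd_add_one, ← ih]
      omega
  exact (key p).2 hp

theorem isOddRelation_oddWalkRel {c : X → Fin 2} (hc : ∀ x y, G.Adj x y → c x ≠ c y) :
    IsOddRelation (OddWalkRel G) where
  symm := fun ⟨p, hp⟩ => ⟨p.reverse, by rwa [SimpleGraph.Walk.length_reverse]⟩
  irrefl := fun _ h => h.ne hc rfl
  comp := fun ⟨p, hp⟩ ⟨q, hq⟩ ⟨r, hr⟩ => ⟨(p.append q).append r, by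
    rw [SimpleGraph.Walk.length_append, SimpleGraph.Walk.length_append]
    exact (hp.add_odd hq).add_odd hr⟩

variable [TopologicalSpace X] [PolishSpace X]

theorem analyticSet_exists_walk (hG : AnalyticSet {p : X × X | G.Adj p.1 p.2}) (n : ℕ) :
    AnalyticSet {p : X × X | ∃ w : G.Walk p.1 p.2, w.length = n} := by
  induction n with
  | zero =>
    convert (isClosed_diagonal (X := X)).analyticSet using 1
    ext ⟨x, y⟩
    simp only [mem_ofPred_eq, mem_diagonal_iff]
    exact ⟨fun ⟨w, hw⟩ => SimpleGraph.Walk.eq_of_length_eq_zero hw, fun h => by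
      subst h
      exact ⟨.nil, rfl⟩⟩
  | succ n ih =>
    have h1 : AnalyticSet {q : X × X × X | G.Adj q.1 q.2.1} :=
      hG.preimage (continuous_fst.prodMk (continuous_fst.comp continuous_snd))
    have h2 : AnalyticSet {q : X × X × X | ∃ w : G.Walk q.2.1 q.2.2, w.length = n} :=
      ih.preimage continuous_snd
    convert (h1.inter h2).image_of_continuous
      (continuous_fst.prodMk (continuous_snd.comp continuous_snd)) using 1
    ext ⟨x, z⟩
    simp only [mem_ofPred_eq, mem_image, mem_inter_iff, Prod.mk.injEq, Prod.exists]
    constructor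
    · rintro ⟨w, hw⟩
      cases w with
      | nil => simp at hw
      | cons h p => exact ⟨_, _, _, ⟨h, p, by simpa using hw⟩, rfl, rfl⟩
    · rintro ⟨x, y, z, ⟨h, p, hp⟩, rfl, rfl⟩
      exact ⟨.cons h p, by simp [hp]⟩

theorem analyticSet_oddWalkRel (hG : AnalyticSet {p : X × X | G.Adj p.1 p.2}) :
    AnalyticSet {p : X × X | OddWalkRel G p.1 p.2} := by
  convert AnalyticSet.iUnion fun k : ℕ => analyticSet_exists_walk hG (2 * k + 1) using 1
  ext p
  simp only [mem_ofPred_eq, mem_iUnion, OddWalkRel, Odd]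
  exact exists_comm

/-- A Borel graph with a 2-coloring but no Borel 2-coloring contains, in the relation of being
joined by an odd walk, a continuous injective copy of the bit-flipping graph. -/
theorem exists_continuous_injective_flipBit_oddWalkRel [MeasurableSpace X] [BorelSpace X]
    (hG : MeasurableSet {p : X × X | G.Adj p.1 p.2})
    {c : X → Fin 2} (hc : ∀ x y, G.Adj x y → c x ≠ c y)
    (hG' : ¬ ∃ c : X → Fin 2, Measurable c ∧ ∀ x y, G.Adj x y → c x ≠ c y) :
    ∃ φ : (ℕ → Bool) → X, Continuous φ ∧ Function.Injective φ ∧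
      ∀ c : X → Fin 2, (∀ x y, G.Adj x y → c x ≠ c y) → ∀ n x, c (φ x) ≠ c (φ (flipBit n x)) := by
  obtain ⟨φ, h1, h2, h3⟩ := exists_continuous_injective_flipBit (isOddRelation_oddWalkRel hc)
    (analyticSet_oddWalkRel hG.analyticSet)
    (fun ⟨c, hcm, hc⟩ => hG' ⟨c, hcm, fun x y h => hc x y (.of_adj h)⟩)
  exact ⟨φ, h1, h2, fun c hc n x => (h3 n x).ne hc⟩

end OddWalk

section FlipBit

theorem flipBit_flipBit (n : ℕ) (x : ℕ → Bool) : flipBit n (flipBit n x) = x := by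
  funext i
  by_cases h : i = n <;> simp [flipBit, h]

theorem flipBit_apply_of_notMem {n : ℕ} {s : Finset ℕ} (hn : n ∉ s) (x : ℕ → Bool) (i : ℕ)
    (hi : i ∈ s) : flipBit n x i = x i :=
  if_neg (ne_of_mem_of_not_mem hi hn)

theorem continuous_flipBit (n : ℕ) : Continuous (flipBit n) := by
  refine continuous_pi fun i => ?_
  have h : Continuous fun x : ℕ → Bool => x i := continuous_apply i
  by_cases hi : i = n
  · simp only [flipBit, if_pos hi]
    exact (continuous_of_discreteTopology (f := not)).comp h
  · simpa only [flipBit, if_neg hi] using h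

theorem isOpenMap_flipBit (n : ℕ) : IsOpenMap (flipBit n) :=
  (Homeomorph.mk ⟨flipBit n, flipBit n, flipBit_flipBit n, flipBit_flipBit n⟩
    (continuous_flipBit n) (continuous_flipBit n)).isOpenMap

theorem not_baireMeasurableSet_of_flipBit {A : Set (ℕ → Bool)}
    (hA : ∀ n x, flipBit n x ∈ A ↔ x ∉ A) : ¬ BaireMeasurableSet A := by
  intro h
  obtain ⟨U, hU, hAU⟩ := h.residualEq_isOpen
  have hflip : ∀ n, ∀ᶠ x in residual (ℕ → Bool), flipBit n x ∈ A ↔ flipBit n x ∈ U := fun n =>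
    (tendsto_residual_of_isOpenMap (continuous_flipBit n) (isOpenMap_flipBit n)).eventually
      hAU.mem_iff
  rcases U.eq_empty_or_nonempty with rfl | ⟨x, hx⟩
  · obtain ⟨y, h1, h2⟩ := (dense_of_mem_residual (hAU.mem_iff.and (hflip 0))).nonempty
    rw [hA] at h2
    simp only [mem_empty_iff_false, iff_false] at h1 h2
    exact h2 h1
  · obtain ⟨s, t, ht, hts⟩ := isOpen_pi_iff.1 hU x hx
    obtain ⟨n, hn⟩ := Infinite.exists_notMem_finset s
    have hopen : IsOpen ((s : Set ℕ).pi t) := isOpen_set_pi s.finite_toSet fun i hi => (ht i hi).1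
    obtain ⟨y, hy, h1, h2⟩ := (dense_of_mem_residual (hAU.mem_iff.and (hflip n))).inter_open_nonempty
      _ hopen ⟨x, fun i hi => (ht i hi).2⟩
    have hy' : flipBit n y ∈ (s : Set ℕ).pi t := fun i hi => by
      rw [flipBit_apply_of_notMem hn y i hi]
      exact hy i hi
    have h3 := h1.2 (hts hy)
    have h4 := h2.2 (hts hy')
    exact (hA n y).1 h4 h3

/-- The law of a sequence of independent fair coin tosses. -/
noncomputable def coinMeasure : Measure (ℕ → Bool) :=
  Measure.infinitePi fun _ : ℕ => ProbabilityTheory.uniformOn (univ : Set Bool)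

instance : IsProbabilityMeasure (ProbabilityTheory.uniformOn (univ : Set Bool)) :=
  ProbabilityTheory.isProbabilityMeasure_uniformOn finite_univ univ_nonempty

instance : IsProbabilityMeasure coinMeasure := by
  unfold coinMeasure
  infer_instance

theorem map_not_uniformOn :
    (ProbabilityTheory.uniformOn (univ : Set Bool)).map not =
      ProbabilityTheory.uniformOn (univ : Set Bool) := by
  refine Measure.ext_of_singleton fun b => ?_
  have : not ⁻¹' {b} = {!b} := by
    ext a
    simp [Bool.not_eq_eq_eq_not]
  rw [Measure.map_apply (measurable_of_finite _) (measurableSet_singleton b), this,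
    ProbabilityTheory.uniformOn_univ, ProbabilityTheory.uniformOn_univ, Measure.count_singleton,
    Measure.count_singleton]

theorem map_flipBit_coinMeasure (n : ℕ) : coinMeasure.map (flipBit n) = coinMeasure := by
  have := Measure.infinitePi_map_pi (fun _ : ℕ => ProbabilityTheory.uniformOn (univ : Set Bool))
    (f := fun i b => if i = n then !b else b) (fun i => measurable_of_finite _)
  refine this.trans ?_
  unfold coinMeasure
  congr
  funext i
  by_cases h : i = n
  · simp only [if_pos h]
    exact map_not_uniformOn
  · simp only [if_neg h]
    exact Measure.map_id

theorem not_nullMeasurableSet_of_flipBit {A : Set (ℕ → Bool)}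
    (hA : ∀ n x, flipBit n x ∈ A ↔ x ∉ A) : ¬ NullMeasurableSet A coinMeasure := by
  intro h
  have hmp : ∀ n, MeasurePreserving (flipBit n) coinMeasure coinMeasure := fun n =>
    ⟨(continuous_flipBit n).measurable, map_flipBit_coinMeasure n⟩
  have hS : ∀ S ∈ measurableCylinders fun _ : ℕ => Bool,
      coinMeasure (A ∩ S) = coinMeasure (Aᶜ ∩ S) := by
    intro S hS
    obtain ⟨s, T, hT, rfl⟩ := (mem_measurableCylinders S).1 hS
    obtain ⟨n, hn⟩ := Infinite.exists_notMem_finset s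
    have hm : NullMeasurableSet (A ∩ cylinder s T) coinMeasure :=
      h.inter (MeasurableSet.cylinder s hT).nullMeasurableSet
    rw [← (hmp n).measure_preimage hm]
    congr 1
    ext x
    have : (s.restrict (flipBit n x)) = s.restrict x := funext fun i => flipBit_apply_of_notMem hn x i i.2
    simp only [mem_preimage, mem_inter_iff, hA, mem_cylinder, mem_compl_iff, this]
  have hr : coinMeasure.restrict A = coinMeasure.restrict Aᶜ := by
    refine ext_of_generate_finite _ generateFrom_measurableCylinders.symm
      isPiSystem_measurableCylinders (fun S hS' => ?_) ?_
    · have hSm := MeasurableSet.of_mem_measurableCylinders hS'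
      rw [Measure.restrict_apply hSm, Measure.restrict_apply hSm, inter_comm, hS S hS', inter_comm]
    · have := hS univ (univ_mem_measurableCylinders _)
      simpa using this
  have h1 : coinMeasure A = 0 := by
    rw [← Measure.restrict_apply_self, hr, Measure.restrict_apply₀' h.compl, inter_compl_self,
      measure_empty]
  have h2 : coinMeasure Aᶜ = 0 := by
    rw [← Measure.restrict_apply_self, ← hr, Measure.restrict_apply₀' h, compl_inter_self,
      measure_empty]
  have h3 := measure_union_null h1 h2
  rw [union_compl_self, measure_univ] at h3
  exact one_ne_zero h3

end FlipBit

section FinerTopology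

/-- A continuous injection of a compact Polish space into a Polish space becomes an open map for
some finer Polish topology on the target. -/
theorem exists_polishSpace_le_isOpenMap {X Y : Type*} [TopologicalSpace Y] [CompactSpace Y]
    [PolishSpace Y] [t : TopologicalSpace X] [PolishSpace X] {φ : Y → X} (hφ : Continuous φ)
    (hi : Function.Injective φ) :
    ∃ τ : TopologicalSpace X, τ ≤ t ∧ @PolishSpace X τ ∧ @Continuous Y X _ τ φ ∧
      @IsOpenMap Y X _ τ φ := by
  classical
  have : PolishSpace ((range φ)ᶜ : Set X) := (isCompact_range hφ).isClosed.isOpen_compl.polishSpace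
  let e : Y ⊕ ((range φ)ᶜ : Set X) ≃ X :=
    ((Equiv.ofInjective φ hi).sumCongr (Equiv.refl _)).trans (Equiv.Set.sumCompl (range φ))
  have he : ∀ y, e (Sum.inl y) = φ y := fun _ => rfl
  refine ⟨.coinduced e inferInstance, ?_, ?_, ?_, ?_⟩
  · exact continuous_iff_coinduced_le.1 (continuous_sum_dom.2 ⟨hφ, continuous_subtype_val⟩)
  · rw [← e.induced_symm]
    exact e.symm.polishSpace_induced
  · exact continuous_def.2 fun U hU => (isOpen_coinduced.1 hU).preimage continuous_inl
  · intro U hU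
    rw [isOpen_coinduced]
    convert isOpenMap_inl U hU using 1
    ext z
    simp only [mem_preimage, mem_image, ← he, e.apply_eq_iff_eq]

end FinerTopology

section Dichotomy

variable {X : Type*} [MeasurableSpace X] [StandardBorelSpace X] {G : SimpleGraph X}

theorem exists_measurable_two_coloring_of_nullMeasurable
    (hG : MeasurableSet {p : X × X | G.Adj p.1 p.2})
    (h : ∀ μ : Measure X, IsProbabilityMeasure μ →
      ∃ c : X → Fin 2, NullMeasurable c μ ∧ ∀ x y : X, G.Adj x y → c x ≠ c y) :
    ∃ c : X → Fin 2, Measurable c ∧ ∀ x y : X, G.Adj x y → c x ≠ c y := by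
  by_contra hG'
  let := upgradeStandardBorel X
  have hne : Nonempty X := by
    by_contra hX
    rw [not_nonempty_iff] at hX
    exact hG' ⟨fun _ => 0, measurable_const, fun x => isEmptyElim x⟩
  obtain ⟨c₀, -, hc₀⟩ := h (Measure.dirac hne.some) inferInstance
  obtain ⟨φ, hφ, -, hflip⟩ := exists_continuous_injective_flipBit_oddWalkRel hG hc₀ hG'
  obtain ⟨c, hcm, hc⟩ := h (coinMeasure.map φ)
    (Measure.isProbabilityMeasure_map hφ.measurable.aemeasurable)
  refine not_nullMeasurableSet_of_flipBit (A := φ ⁻¹' (c ⁻¹' {0})) (fun n x => ?_)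
    ((hcm (measurableSet_singleton 0)).preimage ⟨hφ.measurable, .rfl⟩)
  have := hflip c hc n x
  simp only [mem_preimage, mem_singleton_iff]
  omega

theorem exists_measurable_two_coloring_of_baireMeasurable
    (hG : MeasurableSet {p : X × X | G.Adj p.1 p.2})
    (h : ∀ τ : TopologicalSpace X, @PolishSpace X τ → @borel X τ = ‹MeasurableSpace X› →
      ∃ c : X → Fin 2, (∀ s : Set (Fin 2), @BaireMeasurableSet X τ (c ⁻¹' s)) ∧
        ∀ x y : X, G.Adj x y → c x ≠ c y) :
    ∃ c : X → Fin 2, Measurable c ∧ ∀ x y : X, G.Adj x y → c x ≠ c y := by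
  by_contra hG'
  obtain ⟨t, hb, ht⟩ := StandardBorelSpace.polish (α := X)
  obtain ⟨c₀, -, hc₀⟩ := h t ht hb.measurable_eq.symm
  obtain ⟨φ, hφ, hi, hflip⟩ := exists_continuous_injective_flipBit_oddWalkRel hG hc₀ hG'
  have : PolishSpace (ℕ → Bool) := {}
  obtain ⟨τ, hle, hτ, hφτ, hφo⟩ := exists_polishSpace_le_isOpenMap hφ hi
  obtain ⟨c, hcm, hc⟩ := h τ hτ ((borel_eq_borel_of_le hτ ht hle).trans hb.measurable_eq.symm)
  refine not_baireMeasurableSet_of_flipBit (A := φ ⁻¹' (c ⁻¹' {0})) (fun n x => ?_)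
    (@BaireMeasurableSet.preimage _ _ _ τ _ hφτ hφo _ (hcm {0}))
  have := hflip c hc n x
  simp only [mem_preimage, mem_singleton_iff]
  omega

end Dichotomy

end TwoColorings

theorem stmt_8 {X : Type*} [mX : MeasurableSpace X] [StandardBorelSpace X]
    (G : SimpleGraph X) (hGmeas : MeasurableSet {p : X × X | G.Adj p.1 p.2})
    (hlc : ∀ x : X, (G.neighborSet x).Countable) :
    ((∃ c : X → Fin 2, Measurable c ∧ ∀ x y : X, G.Adj x y → c x ≠ c y) ↔
      ∀ (μ : Measure X), IsProbabilityMeasure μ →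
        ∃ c : X → Fin 2, NullMeasurable c μ ∧ ∀ x y : X, G.Adj x y → c x ≠ c y) ∧
    ((∃ c : X → Fin 2, Measurable c ∧ ∀ x y : X, G.Adj x y → c x ≠ c y) ↔
      ∀ (τ : TopologicalSpace X), @PolishSpace X τ → @borel X τ = mX →
        ∃ c : X → Fin 2, (∀ s : Set (Fin 2), @BaireMeasurableSet X τ (c ⁻¹' s)) ∧
          ∀ x y : X, G.Adj x y → c x ≠ c y) := by
  refine ⟨⟨?_, exists_measurable_two_coloring_of_nullMeasurable hGmeas⟩,
    ⟨?_, exists_measurable_two_coloring_of_baireMeasurable hGmeas⟩⟩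
  · rintro ⟨c, hcm, hc⟩ μ -
    exact ⟨c, hcm.nullMeasurable, hc⟩
  · rintro ⟨c, hcm, hc⟩ τ - hτ
    have : BorelSpace X := ⟨hτ.symm⟩
    exact ⟨c, fun s => (hcm (Set.toFinite s).measurableSet).baireMeasurableSet, hc⟩
end
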